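/- Let H ∈ (1/6, 1), let (Ω,F,P) be a probability space, and let X¹, X² : ℝ → Ω → ℝ be two independent centered Gaussian processes, each with covariance C_H and with continuous sample paths. Let f ∈ C_b^∞(ℝ²) and fix t > 0. Then, as n → ∞, O_n(f,t) converges in probability to f(X¹_t, X²_t) − f(0,0). (This is the change-of-variable formula f(X_t) = f(0) + ∫₀ᵗ ∇f(X_s) dX_s, where the integral is defined as the limit in probability of the symmetric Riemann sums O_n(f,t).) -/

import Mathlib

open MeasureTheory ProbabilityTheory Filter

noncomputable section

/-- Covariance function of the (two-sided) fractional Brownian motion with Hurst index `H`: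
`C_H(t,s) = (|t|^{2H} + |s|^{2H} − |t−s|^{2H})/2`. -/
def covH (H t s : ℝ) : ℝ :=
  (|t| ^ (2 * H) + |s| ^ (2 * H) - |t - s| ^ (2 * H)) / 2

/-- `ρ_H(k) = (1/2)(|k+1|^{2H} + |k−1|^{2H} − 2|k|^{2H})`. -/
def rhoH (H : ℝ) (k : ℤ) : ℝ :=
  (|(k : ℝ) + 1| ^ (2 * H) + |(k : ℝ) - 1| ^ (2 * H) - 2 * |(k : ℝ)| ^ (2 * H)) / 2

/-- `X` is a centered Gaussian process with covariance function `C` under `P`: every finite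
linear combination of values of the process is a centered real Gaussian random variable with
the appropriate variance. -/
def IsCenteredGaussianProcess {Ω : Type*} [MeasurableSpace Ω] (P : Measure Ω)
    (X : ℝ → Ω → ℝ) (C : ℝ → ℝ → ℝ) : Prop :=
  (∀ t, Measurable (X t)) ∧
  ∀ (m : ℕ) (ts : Fin m → ℝ) (c : Fin m → ℝ),
    Measure.map (fun ω => ∑ i, c i * X (ts i) ω) P =
      gaussianReal 0 (Real.toNNReal (∑ i, ∑ j, c i * c j * C (ts i) (ts j)))

/-- The σ-algebras generated by the two processes `X1` and `X2` are independent under `P`. -/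
def IndepProcesses {Ω : Type*} [MeasurableSpace Ω] (P : Measure Ω)
    (X1 X2 : ℝ → Ω → ℝ) : Prop :=
  ProbabilityTheory.Indep
    (⨆ t : ℝ, MeasurableSpace.comap (X1 t) inferInstance)
    (⨆ t : ℝ, MeasurableSpace.comap (X2 t) inferInstance) P

/-- `g` is infinitely differentiable and bounded together with all its derivatives. -/
def CbSmooth {E : Type*} [NormedAddCommGroup E] [NormedSpace ℝ E] (g : E → ℝ) : Prop :=
  (∀ n : ℕ, ContDiff ℝ n g) ∧
  ∀ k : ℕ, ∃ M : ℝ, ∀ x : E, ‖iteratedFDeriv ℝ k g x‖ ≤ M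

/-- `f : ℝ² → ℝ` (in curried form) belongs to `C_b^∞(ℝ²)`. -/
def CbSmooth2 (f : ℝ → ℝ → ℝ) : Prop :=
  CbSmooth fun p : ℝ × ℝ => f p.1 p.2

/-- Partial derivative of `f : ℝ → ℝ → ℝ`, taken `k` times in the first variable and `l` times
in the second variable. -/
def pd (k l : ℕ) (f : ℝ → ℝ → ℝ) (x y : ℝ) : ℝ :=
  iteratedDeriv k (fun u => iteratedDeriv l (fun v => f u v) y) x

/-- The dyadic point `j·2^{−n/2}`. -/
def dyadicPt (n j : ℕ) : ℝ := (j : ℝ) * (2 : ℝ) ^ (-(n : ℝ) / 2)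

/-- The number of dyadic steps `⌊2^{n/2} t⌋`. -/
def nSteps (n : ℕ) (t : ℝ) : ℕ := Nat.floor ((2 : ℝ) ^ ((n : ℝ) / 2) * t)

variable {Ω : Type*}

/-- The increment `X_{(j+1)2^{−n/2}} − X_{j2^{−n/2}}` of the process `X`. -/
def Xincr (X : ℝ → Ω → ℝ) (n j : ℕ) (ω : Ω) : ℝ :=
  X (dyadicPt n (j + 1)) ω - X (dyadicPt n j) ω

/-- The midpoint evaluation `Δ_{j,n} g(X¹,X²)`. -/
def Xmid (X1 X2 : ℝ → Ω → ℝ) (g : ℝ → ℝ → ℝ) (n j : ℕ) (ω : Ω) : ℝ :=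
  g ((X1 (dyadicPt n (j + 1)) ω + X1 (dyadicPt n j) ω) / 2)
    ((X2 (dyadicPt n (j + 1)) ω + X2 (dyadicPt n j) ω) / 2)

/-- Stein's identity for the standard Gaussian measure. -/
theorem integral_id_mul_gaussianReal {φ φ' : ℝ → ℝ} (h : ∀ x, HasDerivAt φ (φ' x) x)
    (h1 : Integrable φ (gaussianReal 0 1))
    (h2 : Integrable (fun x => x * φ x) (gaussianReal 0 1))
    (h3 : Integrable φ' (gaussianReal 0 1)) :
    ∫ x, x * φ x ∂(gaussianReal 0 1) = ∫ x, φ' x ∂(gaussianReal 0 1) := by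
  have key : ∀ ψ : ℝ → ℝ, Integrable ψ (gaussianReal 0 1) →
      Integrable (fun x => gaussianPDFReal 0 1 x * ψ x) := by
    intro ψ hψ
    rw [gaussianReal_of_var_ne_zero 0 one_ne_zero,
      integrable_withDensity_iff_integrable_smul' (measurable_gaussianPDF 0 1)
        (by simp [gaussianPDF_lt_top])] at hψ
    simpa [toReal_gaussianPDF] using hψ
  have hd : ∀ x, HasDerivAt (gaussianPDFReal 0 1) (-x * gaussianPDFReal 0 1 x) x := by
    intro x
    have : HasDerivAt (fun x : ℝ => (√(2 * Real.pi * (1 : NNReal)))⁻¹ *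
        Real.exp (-(x - 0) ^ 2 / (2 * (1 : NNReal)))) _ x :=
      ((((hasDerivAt_id x).sub_const 0).pow 2).neg.div_const _).exp.const_mul _
    rw [gaussianPDFReal_def]
    refine this.congr_deriv ?_
    simp
    ring
  rw [integral_gaussianReal_eq_integral_smul one_ne_zero,
    integral_gaussianReal_eq_integral_smul one_ne_zero]
  have := integral_mul_deriv_eq_deriv_mul_of_integrable (u := gaussianPDFReal 0 1) (v := φ)
    (fun x _ => hd x) (fun x _ => h x) (key _ h3)
    (by
      refine (key _ h2).neg.congr (Eventually.of_forall fun x => ?_)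
      simp; ring) (key _ h1)
  simp only [smul_eq_mul]
  rw [this, ← integral_neg]
  congr 1; ext x; ring

theorem IndepFun.integral_comp_prod [MeasurableSpace Ω] {P : Measure Ω} [IsProbabilityMeasure P]
    {E F : Type*} [MeasurableSpace E] [MeasurableSpace F] {X : Ω → E} {Y : Ω → F}
    (hX : Measurable X) (hY : Measurable Y) (hI : IndepFun X Y P) {G : E → F → ℝ}
    (hG : Measurable (Function.uncurry G)) (hint : Integrable (fun ω => G (X ω) (Y ω)) P) :
    (∫ ω, G (X ω) (Y ω) ∂P = ∫ ω', ∫ ω, G (X ω) (Y ω') ∂P ∂P) ∧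
      (∀ᵐ ω' ∂P, Integrable (fun ω => G (X ω) (Y ω')) P) := by
  have hmap := (indepFun_iff_map_prod_eq_prod_map_map hX.aemeasurable hY.aemeasurable).1 hI
  have := Measure.isProbabilityMeasure_map (μ := P) hX.aemeasurable
  have := Measure.isProbabilityMeasure_map (μ := P) hY.aemeasurable
  have hint' : Integrable (Function.uncurry G) ((P.map X).prod (P.map Y)) := by
    rw [← hmap, integrable_map_measure hG.aestronglyMeasurable (hX.prodMk hY).aemeasurable]
    exact hint
  have hsec : ∀ y, Measurable fun x => G x y := fun y => hG.comp measurable_prodMk_right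
  constructor
  · calc ∫ ω, G (X ω) (Y ω) ∂P = ∫ z, Function.uncurry G z ∂((P.map X).prod (P.map Y)) := by
          rw [← hmap, integral_map (hX.prodMk hY).aemeasurable hG.aestronglyMeasurable]
          rfl
      _ = ∫ y, ∫ x, G x y ∂(P.map X) ∂(P.map Y) := by
          rw [integral_prod_symm _ hint']; rfl
      _ = ∫ ω', ∫ x, G x (Y ω') ∂(P.map X) ∂P := by
          rw [integral_map hY.aemeasurable]
          exact (hint'.swap.integral_prod_left).aestronglyMeasurable
      _ = _ := by
          congr 1; ext ω'
          rw [integral_map hX.aemeasurable (hsec _).aestronglyMeasurable]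
  · have h := hint'.prod_left_ae
    have h' := ae_of_ae_map hY.aemeasurable h
    filter_upwards [h'] with ω' hω'
    exact (integrable_map_measure (hsec _).aestronglyMeasurable hX.aemeasurable).1 hω'

/-- Gaussian integration by parts with respect to a standard Gaussian variable `U` independent of
`Y`. -/
theorem integral_mul_of_indepFun_gaussianReal [MeasurableSpace Ω] {P : Measure Ω}
    [IsProbabilityMeasure P] {E : Type*} [MeasurableSpace E] {U : Ω → ℝ} {Y : Ω → E}
    (hU : Measurable U) (hY : Measurable Y) (hI : IndepFun U Y P)
    (hlaw : P.map U = gaussianReal 0 1) {φ φ' : ℝ → E → ℝ}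
    (hφ : Measurable (Function.uncurry φ)) (hφ' : Measurable (Function.uncurry φ'))
    (hd : ∀ x y, HasDerivAt (fun z => φ z y) (φ' x y) x)
    (h1 : Integrable (fun ω => φ (U ω) (Y ω)) P)
    (h2 : Integrable (fun ω => U ω * φ (U ω) (Y ω)) P)
    (h3 : Integrable (fun ω => φ' (U ω) (Y ω)) P) :
    ∫ ω, U ω * φ (U ω) (Y ω) ∂P = ∫ ω, φ' (U ω) (Y ω) ∂P := by
  have hφ2 : Measurable (Function.uncurry fun x y => x * φ x y) := measurable_fst.mul hφ
  obtain ⟨-, a1⟩ := IndepFun.integral_comp_prod hU hY hI hφ h1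
  obtain ⟨e2, a2⟩ := IndepFun.integral_comp_prod hU hY hI hφ2 h2
  obtain ⟨e3, a3⟩ := IndepFun.integral_comp_prod hU hY hI hφ' h3
  rw [e2, e3]
  refine integral_congr_ae ?_
  filter_upwards [a1, a2, a3] with ω' b1 b2 b3
  have m1 : Measurable fun x => φ x (Y ω') := hφ.comp measurable_prodMk_right
  have m2 : Measurable fun x => x * φ x (Y ω') := measurable_id.mul m1
  have m3 : Measurable fun x => φ' x (Y ω') := hφ'.comp measurable_prodMk_right
  have tr : ∀ ψ : ℝ → ℝ, Measurable ψ → Integrable (fun ω => ψ (U ω)) P →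
      Integrable ψ (gaussianReal 0 1) := by
    intro ψ hψ hi
    rw [← hlaw, integrable_map_measure hψ.aestronglyMeasurable hU.aemeasurable]
    exact hi
  have := integral_id_mul_gaussianReal (fun x => hd x (Y ω')) (tr _ m1 b1) (tr _ m2 b2) (tr _ m3 b3)
  rwa [← hlaw, integral_map hU.aemeasurable m2.aestronglyMeasurable,
    integral_map hU.aemeasurable m3.aestronglyMeasurable] at this

/-- `(U, V, A, B)` is a centered Gaussian vector whose first two coordinates are standard. -/
structure GaussQuad [MeasurableSpace Ω] (P : Measure Ω) (U V A B : Ω → ℝ) : Prop where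
  law : HasGaussianLaw (fun ω => (U ω, V ω, A ω, B ω)) P
  mU : Measurable U
  mV : Measurable V
  mA : Measurable A
  mB : Measurable B
  lawU : P.map U = gaussianReal 0 1
  lawV : P.map V = gaussianReal 0 1
  meanA : ∫ ω, A ω ∂P = 0
  meanB : ∫ ω, B ω ∂P = 0

/-- `g i` is the `i`-th derivative of `g 0`, and it is bounded by `M i`. -/
structure DerivSeq (M : ℕ → ℝ) (g : ℕ → ℝ → ℝ) : Prop where
  deriv : ∀ i x, HasDerivAt (g i) (g (i + 1) x) x
  bound : ∀ i x, |g i x| ≤ M i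

theorem DerivSeq.shift {M : ℕ → ℝ} {g : ℕ → ℝ → ℝ} (h : DerivSeq M g) :
    DerivSeq (fun i => M (i + 1)) (fun i => g (i + 1)) :=
  ⟨fun i => h.deriv (i + 1), fun i => h.bound (i + 1)⟩

theorem DerivSeq.continuous {M : ℕ → ℝ} {g : ℕ → ℝ → ℝ} (h : DerivSeq M g) (i : ℕ) :
    Continuous (g i) :=
  continuous_iff_continuousAt.2 fun x => (h.deriv i x).continuousAt

theorem DerivSeq.measurable {M : ℕ → ℝ} {g : ℕ → ℝ → ℝ} (h : DerivSeq M g) (i : ℕ) :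
    Measurable (g i) := (h.continuous i).measurable

theorem DerivSeq.nonneg {M : ℕ → ℝ} {g : ℕ → ℝ → ℝ} (h : DerivSeq M g) (i : ℕ) : 0 ≤ M i :=
  (abs_nonneg _).trans (h.bound i 0)

/-- The absolute moments of the standard Gaussian measure. -/
def absMoment (k : ℕ) : ℝ := ∫ x, |x| ^ k ∂(gaussianReal 0 1)

theorem absMoment_nonneg (k : ℕ) : 0 ≤ absMoment k :=
  integral_nonneg fun x => by positivity

theorem integrable_abs_pow_gaussianReal (k : ℕ) :
    Integrable (fun x : ℝ => |x| ^ k) (gaussianReal 0 1) := by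
  have := (memLp_id_gaussianReal' (μ := 0) (v := 1) (k : ENNReal) (by simp)).integrable_norm_pow'
  simpa using this

section moments
variable [MeasurableSpace Ω] {P : Measure Ω} {U V : Ω → ℝ}

theorem integrable_abs_pow (mU : Measurable U) (lU : P.map U = gaussianReal 0 1) (k : ℕ) :
    Integrable (fun ω => |U ω| ^ k) P := by
  have h := integrable_abs_pow_gaussianReal k
  rw [← lU, integrable_map_measure (by fun_prop) mU.aemeasurable] at h
  exact h

theorem integral_abs_pow (mU : Measurable U) (lU : P.map U = gaussianReal 0 1) (k : ℕ) :
    ∫ ω, |U ω| ^ k ∂P = absMoment k := by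
  rw [absMoment, ← lU, integral_map mU.aemeasurable (by fun_prop)]

theorem abs_pow_mul_abs_pow_le (x y : ℝ) (a b : ℕ) :
    |x| ^ a * |y| ^ b ≤ |x| ^ (2 * a) + |y| ^ (2 * b) := by
  rw [mul_comm 2 a, mul_comm 2 b, pow_mul, pow_mul]
  nlinarith [sq_nonneg (|x| ^ a - |y| ^ b), sq_nonneg (|x| ^ a), sq_nonneg (|y| ^ b)]

theorem integrable_abs_pow_mul (mU : Measurable U) (lU : P.map U = gaussianReal 0 1)
    (mV : Measurable V) (lV : P.map V = gaussianReal 0 1) (a b : ℕ) :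
    Integrable (fun ω => |U ω| ^ a * |V ω| ^ b) P := by
  refine ((integrable_abs_pow mU lU (2 * a)).add (integrable_abs_pow mV lV (2 * b))).mono'
    (by fun_prop) (Eventually.of_forall fun ω => ?_)
  rw [Real.norm_of_nonneg (by positivity)]
  exact abs_pow_mul_abs_pow_le _ _ a b

theorem integral_abs_pow_mul_le (mU : Measurable U) (lU : P.map U = gaussianReal 0 1)
    (mV : Measurable V) (lV : P.map V = gaussianReal 0 1) (a b : ℕ) :
    ∫ ω, |U ω| ^ a * |V ω| ^ b ∂P ≤ absMoment (2 * a) + absMoment (2 * b) := by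
  rw [← integral_abs_pow mU lU, ← integral_abs_pow mV lV,
    ← integral_add (integrable_abs_pow mU lU _) (integrable_abs_pow mV lV _)]
  exact integral_mono (integrable_abs_pow_mul mU lU mV lV a b)
    ((integrable_abs_pow mU lU _).add (integrable_abs_pow mV lV _))
    fun ω => abs_pow_mul_abs_pow_le _ _ a b

end moments

namespace GaussQuad
variable [MeasurableSpace Ω] {P : Measure Ω} {U V A B : Ω → ℝ}

theorem swap (q : GaussQuad P U V A B) : GaussQuad P V U A B where
  law := q.law.map_fun
    (((ContinuousLinearMap.fst ℝ ℝ (ℝ × ℝ)).comp (ContinuousLinearMap.snd ℝ ℝ (ℝ × ℝ × ℝ))).prod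
      ((ContinuousLinearMap.fst ℝ ℝ (ℝ × ℝ × ℝ)).prod
        ((ContinuousLinearMap.snd ℝ ℝ (ℝ × ℝ)).comp (ContinuousLinearMap.snd ℝ ℝ (ℝ × ℝ × ℝ)))))
  mU := q.mV
  mV := q.mU
  mA := q.mA
  mB := q.mB
  lawU := q.lawV
  lawV := q.lawU
  meanA := q.meanA
  meanB := q.meanB

theorem integrable (q : GaussQuad P U V A B) {M N : ℕ → ℝ} {g h : ℕ → ℝ → ℝ} (hg : DerivSeq M g)
    (hh : DerivSeq N h) (a b i j : ℕ) :
    Integrable (fun ω => U ω ^ a * V ω ^ b * g i (A ω) * h j (B ω)) P := by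
  have := hg.measurable i
  have := hh.measurable j
  have := q.mU
  have := q.mV
  have := q.mA
  have := q.mB
  refine ((integrable_abs_pow_mul q.mU q.lawU q.mV q.lawV a b).mul_const (M i * N j)).mono'
    (by fun_prop) (Eventually.of_forall fun ω => ?_)
  rw [Real.norm_eq_abs, mul_assoc, abs_mul, abs_mul, abs_mul, abs_pow, abs_pow]
  have := hg.bound i (A ω)
  have := hh.bound j (B ω)
  have := hg.nonneg i
  gcongr

theorem abs_integral_le (q : GaussQuad P U V A B) {M N : ℕ → ℝ} {g h : ℕ → ℝ → ℝ}
    (hg : DerivSeq M g) (hh : DerivSeq N h) (a b i j : ℕ) :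
    |∫ ω, U ω ^ a * V ω ^ b * g i (A ω) * h j (B ω) ∂P| ≤
      (absMoment (2 * a) + absMoment (2 * b)) * (M i * N j) := by
  refine (abs_integral_le_integral_abs).trans ?_
  have hMN : 0 ≤ M i * N j := mul_nonneg (hg.nonneg i) (hh.nonneg j)
  refine le_trans ?_ (mul_le_mul_of_nonneg_right
    (integral_abs_pow_mul_le q.mU q.lawU q.mV q.lawV a b) hMN)
  rw [← integral_mul_const]
  refine integral_mono (q.integrable hg hh a b i j).abs
    ((integrable_abs_pow_mul q.mU q.lawU q.mV q.lawV a b).mul_const _) fun ω => ?_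
  simp only []
  rw [mul_assoc, abs_mul, abs_mul, abs_mul, abs_pow, abs_pow]
  have := hg.bound i (A ω)
  have := hh.bound j (B ω)
  have := hg.nonneg i
  gcongr

end GaussQuad

namespace GaussQuad
variable [MeasurableSpace Ω] {P : Measure Ω} {U V A B : Ω → ℝ}

theorem memLp_two (q : GaussQuad P U V A B) :
    MemLp U 2 P ∧ MemLp V 2 P ∧ MemLp A 2 P ∧ MemLp B 2 P :=
  ⟨q.law.fst.memLp_two, q.law.snd.fst.memLp_two, q.law.snd.snd.fst.memLp_two,
    q.law.snd.snd.snd.memLp_two⟩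

theorem mean_eq_zero_of_map_eq {X : Ω → ℝ} (mX : Measurable X) (lX : P.map X = gaussianReal 0 1) :
    ∫ ω, X ω ∂P = 0 := by
  have := integral_id_gaussianReal (μ := 0) (v := 1)
  rwa [← lX, integral_map mX.aemeasurable (by fun_prop)] at this

theorem integral_sq_of_map_eq {X : Ω → ℝ} (mX : Measurable X)
    (lX : P.map X = gaussianReal 0 1) : ∫ ω, X ω * X ω ∂P = 1 := by
  have h := variance_id_gaussianReal (μ := 0) (v := 1)
  rw [variance_eq_sub (memLp_id_gaussianReal 2)] at h
  simp only [id, integral_id_gaussianReal, Pi.pow_apply] at h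
  rw [← lX, integral_map mX.aemeasurable (by fun_prop)] at h
  simpa [sq] using h

/-- The residual of `(V, A, B)` after linear regression on `U`. -/
def resid (P : Measure Ω) (U V A B : Ω → ℝ) (ω : Ω) : ℝ × ℝ × ℝ :=
  (V ω - (∫ ω, U ω * V ω ∂P) * U ω, A ω - (∫ ω, U ω * A ω ∂P) * U ω,
    B ω - (∫ ω, U ω * B ω ∂P) * U ω)

theorem measurable_resid (q : GaussQuad P U V A B) : Measurable (resid P U V A B) := by
  have := q.mU
  have := q.mV
  have := q.mA
  have := q.mB
  unfold resid
  fun_prop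

theorem indepFun_resid [IsProbabilityMeasure P] (q : GaussQuad P U V A B) :
    IndepFun U (resid P U V A B) P := by
  obtain ⟨mU, mV, mA, mB⟩ := q.memLp_two
  refine HasGaussianLaw.indepFun_of_covariance_strongDual ?_ ?_
  · let p1 := ContinuousLinearMap.fst ℝ ℝ (ℝ × ℝ × ℝ)
    let r1 := ContinuousLinearMap.snd ℝ ℝ (ℝ × ℝ × ℝ)
    let p2 := (ContinuousLinearMap.fst ℝ ℝ (ℝ × ℝ)).comp r1
    let r2 := (ContinuousLinearMap.snd ℝ ℝ (ℝ × ℝ)).comp r1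
    let p3 := (ContinuousLinearMap.fst ℝ ℝ ℝ).comp r2
    let p4 := (ContinuousLinearMap.snd ℝ ℝ ℝ).comp r2
    exact q.law.map_fun (p1.prod ((p2 - (∫ ω, U ω * V ω ∂P) • p1).prod
      ((p3 - (∫ ω, U ω * A ω ∂P) • p1).prod (p4 - (∫ ω, U ω * B ω ∂P) • p1))))
  · intro L₁ L₂
    have hL1 : L₁ ∘ U = fun ω => L₁ 1 * U ω := by
      ext ω
      have := L₁.map_smul (U ω) 1
      simp only [smul_eq_mul, mul_one] at this
      simp [this, mul_comm]
    have hL2 : L₂ ∘ resid P U V A B = fun ω =>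
        L₂ (1, 0, 0) * (V ω - (∫ ω, U ω * V ω ∂P) * U ω) +
        L₂ (0, 1, 0) * (A ω - (∫ ω, U ω * A ω ∂P) * U ω) +
        L₂ (0, 0, 1) * (B ω - (∫ ω, U ω * B ω ∂P) * U ω) := by
      ext ω
      have : ∀ x y z : ℝ, L₂ (x, y, z) = L₂ (1, 0, 0) * x + L₂ (0, 1, 0) * y + L₂ (0, 0, 1) * z := by
        intro x y z
        have e : (x, y, z) = x • ((1, 0, 0) : ℝ × ℝ × ℝ) + y • ((0, 1, 0) : ℝ × ℝ × ℝ)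
          + z • ((0, 0, 1) : ℝ × ℝ × ℝ) := by simp
        rw [e, map_add, map_add, map_smul, map_smul, map_smul]
        simp only [smul_eq_mul]
        ring
      exact this _ _ _
    have key : ∀ Y : Ω → ℝ, MemLp Y 2 P →
        cov[U, fun ω => Y ω - (∫ ω, U ω * Y ω ∂P) * U ω; P] = 0 := by
      intro Y hY
      have h0 : ∫ ω, U ω ∂P = 0 := mean_eq_zero_of_map_eq q.mU q.lawU
      rw [covariance_fun_sub_right mU hY (mU.const_mul _), covariance_const_mul_right,
        covariance_eq_sub mU hY, covariance_eq_sub mU mU, h0]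
      have := integral_sq_of_map_eq q.mU q.lawU
      simp [Pi.mul_apply, this]
    have m1 : ∀ Y : Ω → ℝ, MemLp Y 2 P → ∀ c : ℝ,
        MemLp (fun ω => c * (Y ω - (∫ ω, U ω * Y ω ∂P) * U ω)) 2 P := fun Y hY c =>
      (hY.sub (mU.const_mul _)).const_mul c
    have hadd : ∀ Y Z : Ω → ℝ, MemLp Y 2 P → MemLp Z 2 P →
        cov[U, fun ω => Y ω + Z ω; P] = cov[U, Y; P] + cov[U, Z; P] := fun Y Z hY hZ =>
      covariance_add_right mU hY hZ
    have hm : ∀ Y Z : Ω → ℝ, MemLp Y 2 P → MemLp Z 2 P → MemLp (fun ω => Y ω + Z ω) 2 P :=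
      fun Y Z hY hZ => hY.add hZ
    rw [hL1, hL2, covariance_const_mul_left, hadd _ _ (hm _ _ (m1 V mV _) (m1 A mA _)) (m1 B mB _),
      hadd _ _ (m1 V mV _) (m1 A mA _), covariance_const_mul_right,
      covariance_const_mul_right, covariance_const_mul_right, key V mV, key A mA, key B mB]
    simp

theorem integral_four_mul {f₁ f₂ f₃ f₄ : Ω → ℝ} (h₁ : Integrable f₁ P) (h₂ : Integrable f₂ P)
    (h₃ : Integrable f₃ P) (h₄ : Integrable f₄ P) (c₁ c₂ c₃ c₄ : ℝ) :
    ∫ ω, (c₁ * f₁ ω + c₂ * f₂ ω + c₃ * f₃ ω + c₄ * f₄ ω) ∂P =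
      c₁ * ∫ ω, f₁ ω ∂P + c₂ * ∫ ω, f₂ ω ∂P + c₃ * ∫ ω, f₃ ω ∂P + c₄ * ∫ ω, f₄ ω ∂P := by
  have := integral_add (((h₁.const_mul c₁).add (h₂.const_mul c₂)).add (h₃.const_mul c₃))
    (h₄.const_mul c₄)
  have h' := integral_add ((h₁.const_mul c₁).add (h₂.const_mul c₂)) (h₃.const_mul c₃)
  have h'' := integral_add (h₁.const_mul c₁) (h₂.const_mul c₂)
  simp only [Pi.add_apply, integral_const_mul] at this h' h''
  rw [this, h', h'']

theorem integral_succ_pow [IsProbabilityMeasure P] (q : GaussQuad P U V A B) {M N : ℕ → ℝ}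
    {g h : ℕ → ℝ → ℝ} (hg : DerivSeq M g) (hh : DerivSeq N h) (a b i j : ℕ) :
    ∫ ω, U ω ^ (a + 1) * V ω ^ b * g i (A ω) * h j (B ω) ∂P =
      a * ∫ ω, U ω ^ (a - 1) * V ω ^ b * g i (A ω) * h j (B ω) ∂P +
      b * (∫ ω, U ω * V ω ∂P) * ∫ ω, U ω ^ a * V ω ^ (b - 1) * g i (A ω) * h j (B ω) ∂P +
      (∫ ω, U ω * A ω ∂P) * ∫ ω, U ω ^ a * V ω ^ b * g (i + 1) (A ω) * h j (B ω) ∂P +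
      (∫ ω, U ω * B ω ∂P) * ∫ ω, U ω ^ a * V ω ^ b * g i (A ω) * h (j + 1) (B ω) ∂P := by
  set c1 := ∫ ω, U ω * V ω ∂P with hc1
  set c2 := ∫ ω, U ω * A ω ∂P with hc2
  set c3 := ∫ ω, U ω * B ω ∂P with hc3
  let φ : ℝ → ℝ × ℝ × ℝ → ℝ := fun x y =>
    x ^ a * (y.1 + c1 * x) ^ b * g i (y.2.1 + c2 * x) * h j (y.2.2 + c3 * x)
  let φ' : ℝ → ℝ × ℝ × ℝ → ℝ := fun x y =>
    a * (x ^ (a - 1) * (y.1 + c1 * x) ^ b * g i (y.2.1 + c2 * x) * h j (y.2.2 + c3 * x)) +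
    b * c1 * (x ^ a * (y.1 + c1 * x) ^ (b - 1) * g i (y.2.1 + c2 * x) * h j (y.2.2 + c3 * x)) +
    c2 * (x ^ a * (y.1 + c1 * x) ^ b * g (i + 1) (y.2.1 + c2 * x) * h j (y.2.2 + c3 * x)) +
    c3 * (x ^ a * (y.1 + c1 * x) ^ b * g i (y.2.1 + c2 * x) * h (j + 1) (y.2.2 + c3 * x))
  have hd : ∀ x y, HasDerivAt (fun z => φ z y) (φ' x y) x := by
    intro x y
    have l : ∀ s c : ℝ, HasDerivAt (fun z : ℝ => s + c * z) c x := fun s c => by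
      simpa using ((hasDerivAt_id x).const_mul c).const_add s
    have := (((hasDerivAt_pow a x).mul ((l y.1 c1).pow b)).mul
      ((hg.deriv i (y.2.1 + c2 * x)).comp x (l y.2.1 c2))).mul
      ((hh.deriv j (y.2.2 + c3 * x)).comp x (l y.2.2 c3))
    refine this.congr_deriv ?_
    simp only [φ', Pi.mul_apply, Pi.pow_apply, Function.comp_apply]
    ring
  have cg := hg.continuous
  have ch := hh.continuous
  have hφ : Measurable (Function.uncurry φ) := by
    have : Continuous (Function.uncurry φ) := by
      have := cg i; have := ch j
      simp only [φ, Function.uncurry_def]; fun_prop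
    exact this.measurable
  have hφ' : Measurable (Function.uncurry φ') := by
    have : Continuous (Function.uncurry φ') := by
      have := cg i; have := ch j; have := cg (i + 1); have := ch (j + 1)
      simp only [φ', Function.uncurry_def]; fun_prop
    exact this.measurable
  have I1 := q.integrable hg hh (a - 1) b i j
  have I2 := q.integrable hg hh a (b - 1) i j
  have I3 := q.integrable hg hh a b (i + 1) j
  have I4 := q.integrable hg hh a b i (j + 1)
  have e1 : ∀ ω, φ (U ω) (resid P U V A B ω) = U ω ^ a * V ω ^ b * g i (A ω) * h j (B ω) := by
    intro ω; simp [φ, resid, c1, c2, c3]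
  have e2 : ∀ ω, U ω * φ (U ω) (resid P U V A B ω) =
      U ω ^ (a + 1) * V ω ^ b * g i (A ω) * h j (B ω) := by
    intro ω; rw [e1]; ring
  have e3 : ∀ ω, φ' (U ω) (resid P U V A B ω) =
      a * (U ω ^ (a - 1) * V ω ^ b * g i (A ω) * h j (B ω)) +
      b * c1 * (U ω ^ a * V ω ^ (b - 1) * g i (A ω) * h j (B ω)) +
      c2 * (U ω ^ a * V ω ^ b * g (i + 1) (A ω) * h j (B ω)) +
      c3 * (U ω ^ a * V ω ^ b * g i (A ω) * h (j + 1) (B ω)) := by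
    intro ω; simp [φ', resid, c1, c2, c3]
  have main := integral_mul_of_indepFun_gaussianReal q.mU q.measurable_resid q.indepFun_resid
    q.lawU hφ hφ' hd
    (by simp only [e1]; exact q.integrable hg hh a b i j)
    (by simp only [e2]; exact q.integrable hg hh (a + 1) b i j)
    (by
      simp only [e3]
      exact (((I1.const_mul _).add (I2.const_mul _)).add (I3.const_mul _)).add (I4.const_mul _))
  simp only [e2, e3] at main
  rw [main]
  exact integral_four_mul I1 I2 I3 I4 _ _ _ _

end GaussQuad

namespace GaussQuad
variable [MeasurableSpace Ω] {P : Measure Ω}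

theorem exists_bound_odd_left [IsProbabilityMeasure P] (k b : ℕ) (M N : ℕ → ℝ) :
    ∃ C, 0 ≤ C ∧ ∀ (U V A B : Ω → ℝ) (g h : ℕ → ℝ → ℝ), GaussQuad P U V A B → DerivSeq M g →
      DerivSeq N h → |∫ ω, U ω ^ (2 * k + 1) * V ω ^ b * g 0 (A ω) * h 0 (B ω) ∂P| ≤
        C * (|∫ ω, U ω * V ω ∂P| + |∫ ω, U ω * A ω ∂P| + |∫ ω, U ω * B ω ∂P|) := by
  have hnn : ∀ i, 0 ≤ absMoment i := absMoment_nonneg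
  induction k with
  | zero =>
    refine ⟨b * (absMoment (2 * 0) + absMoment (2 * (b - 1))) * |M 0 * N 0| +
      (absMoment (2 * 0) + absMoment (2 * b)) * |M 1 * N 0| +
      (absMoment (2 * 0) + absMoment (2 * b)) * |M 0 * N 1|, ?_, ?_⟩
    · have := hnn (2 * 0)
      have := hnn (2 * b)
      have := hnn (2 * (b - 1))
      positivity
    intro U V A B g h q hg hh
    have e := q.integral_succ_pow hg hh 0 b 0 0
    have t1 := q.abs_integral_le hg hh 0 (b - 1) 0 0
    have t2 := q.abs_integral_le hg hh 0 b 1 0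
    have t3 := q.abs_integral_le hg hh 0 b 0 1
    simp only [Nat.cast_zero, zero_mul, zero_add, Nat.mul_zero] at e t1 t2 t3 ⊢
    rw [e]
    have n1 := mul_nonneg (hg.nonneg 0) (hh.nonneg 0)
    have n2 := mul_nonneg (hg.nonneg 1) (hh.nonneg 0)
    have n3 := mul_nonneg (hg.nonneg 0) (hh.nonneg 1)
    rw [abs_of_nonneg n1, abs_of_nonneg n2, abs_of_nonneg n3]
    set r := ∫ ω, U ω * V ω ∂P
    set α := ∫ ω, U ω * A ω ∂P
    set β := ∫ ω, U ω * B ω ∂P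
    have k0 := hnn 0
    have k1 := hnn (2 * b)
    have k2 := hnn (2 * (b - 1))
    calc _ ≤ b * |r| * ((absMoment 0 + absMoment (2 * (b - 1))) * (M 0 * N 0)) +
          |α| * ((absMoment 0 + absMoment (2 * b)) * (M 1 * N 0)) +
          |β| * ((absMoment 0 + absMoment (2 * b)) * (M 0 * N 1)) := by
          refine (abs_add_three _ _ _).trans ?_
          rw [abs_mul, abs_mul, abs_mul, abs_mul, Nat.abs_cast]
          gcongr
      _ ≤ _ := by
          have a1 : (0:ℝ) ≤ b * (absMoment 0 + absMoment (2 * (b - 1))) * (M 0 * N 0) := by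
            positivity
          have a2 : 0 ≤ (absMoment 0 + absMoment (2 * b)) * (M 1 * N 0) := by positivity
          have a3 : 0 ≤ (absMoment 0 + absMoment (2 * b)) * (M 0 * N 1) := by positivity
          nlinarith [abs_nonneg r, abs_nonneg α, abs_nonneg β, mul_nonneg a1 (abs_nonneg α),
            mul_nonneg a1 (abs_nonneg β), mul_nonneg a2 (abs_nonneg r),
            mul_nonneg a2 (abs_nonneg β), mul_nonneg a3 (abs_nonneg r),
            mul_nonneg a3 (abs_nonneg α)]
  | succ k ih =>
    obtain ⟨C, hC, ih⟩ := ih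
    refine ⟨(2 * k + 2 : ℕ) * C +
      b * (absMoment (2 * (2 * k + 2)) + absMoment (2 * (b - 1))) * |M 0 * N 0| +
      (absMoment (2 * (2 * k + 2)) + absMoment (2 * b)) * |M 1 * N 0| +
      (absMoment (2 * (2 * k + 2)) + absMoment (2 * b)) * |M 0 * N 1|, ?_, ?_⟩
    · have := hnn (2 * (2 * k + 2))
      have := hnn (2 * b)
      have := hnn (2 * (b - 1))
      positivity
    intro U V A B g h q hg hh
    have e := q.integral_succ_pow hg hh (2 * k + 2) b 0 0
    have t0 := ih U V A B g h q hg hh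
    have t1 := q.abs_integral_le hg hh (2 * k + 2) (b - 1) 0 0
    have t2 := q.abs_integral_le hg hh (2 * k + 2) b 1 0
    have t3 := q.abs_integral_le hg hh (2 * k + 2) b 0 1
    rw [show 2 * k + 2 - 1 = 2 * k + 1 by omega] at e
    simp only [zero_add] at e t1 t2 t3
    rw [show 2 * (k + 1) + 1 = 2 * k + 2 + 1 by ring, e]
    have n1 := mul_nonneg (hg.nonneg 0) (hh.nonneg 0)
    have n2 := mul_nonneg (hg.nonneg 1) (hh.nonneg 0)
    have n3 := mul_nonneg (hg.nonneg 0) (hh.nonneg 1)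
    rw [abs_of_nonneg n1, abs_of_nonneg n2, abs_of_nonneg n3]
    set r := ∫ ω, U ω * V ω ∂P
    set α := ∫ ω, U ω * A ω ∂P
    set β := ∫ ω, U ω * B ω ∂P
    have k0 := hnn (2 * (2 * k + 2))
    have k1 := hnn (2 * b)
    have k2 := hnn (2 * (b - 1))
    calc _ ≤ (2 * k + 2 : ℕ) * (C * (|r| + |α| + |β|)) +
          b * |r| * ((absMoment (2 * (2 * k + 2)) + absMoment (2 * (b - 1))) * (M 0 * N 0)) +
          |α| * ((absMoment (2 * (2 * k + 2)) + absMoment (2 * b)) * (M 1 * N 0)) +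
          |β| * ((absMoment (2 * (2 * k + 2)) + absMoment (2 * b)) * (M 0 * N 1)) := by
          refine (abs_add_le _ _).trans (add_le_add ((abs_add_three _ _ _).trans ?_) ?_)
          · rw [abs_mul, abs_mul, abs_mul, abs_mul, Nat.abs_cast, Nat.abs_cast]
            gcongr
          · rw [abs_mul]
            gcongr
      _ ≤ _ := by
          have a1 : (0:ℝ) ≤ b * (absMoment (2 * (2 * k + 2)) + absMoment (2 * (b - 1))) *
            (M 0 * N 0) := by positivity
          have a2 : 0 ≤ (absMoment (2 * (2 * k + 2)) + absMoment (2 * b)) * (M 1 * N 0) := by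
            positivity
          have a3 : 0 ≤ (absMoment (2 * (2 * k + 2)) + absMoment (2 * b)) * (M 0 * N 1) := by
            positivity
          nlinarith [abs_nonneg r, abs_nonneg α, abs_nonneg β, mul_nonneg a1 (abs_nonneg α),
            mul_nonneg a1 (abs_nonneg β), mul_nonneg a2 (abs_nonneg r),
            mul_nonneg a2 (abs_nonneg β), mul_nonneg a3 (abs_nonneg r),
            mul_nonneg a3 (abs_nonneg α)]

end GaussQuad

namespace GaussQuad
variable [MeasurableSpace Ω] {P : Measure Ω}

theorem exists_bound_odd_right [IsProbabilityMeasure P] (a l : ℕ) (M N : ℕ → ℝ) :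
    ∃ C, 0 ≤ C ∧ ∀ (U V A B : Ω → ℝ) (g h : ℕ → ℝ → ℝ), GaussQuad P U V A B → DerivSeq M g →
      DerivSeq N h → |∫ ω, U ω ^ a * V ω ^ (2 * l + 1) * g 0 (A ω) * h 0 (B ω) ∂P| ≤
        C * (|∫ ω, U ω * V ω ∂P| + |∫ ω, V ω * A ω ∂P| + |∫ ω, V ω * B ω ∂P|) := by
  obtain ⟨C, hC, H⟩ := exists_bound_odd_left (P := P) l a M N
  refine ⟨C, hC, fun U V A B g h q hg hh => ?_⟩
  simpa only [mul_comm] using H V U A B g h q.swap hg hh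

/-- One step of the double-odd estimate: integrating by parts an odd power of `U` leaves a term
with a lower odd power, a term carrying `E[UV]`, and terms in which `V` still has odd power. -/
theorem exists_bound_odd_odd [IsProbabilityMeasure P] (k l : ℕ) (M N : ℕ → ℝ) :
    ∃ C, 0 ≤ C ∧ ∀ (U V A B : Ω → ℝ) (g h : ℕ → ℝ → ℝ), GaussQuad P U V A B → DerivSeq M g →
      DerivSeq N h → |∫ ω, U ω * A ω ∂P| ≤ 1 → |∫ ω, U ω * B ω ∂P| ≤ 1 →
      |∫ ω, U ω ^ (2 * k + 1) * V ω ^ (2 * l + 1) * g 0 (A ω) * h 0 (B ω) ∂P| ≤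
        C * (|∫ ω, U ω * V ω ∂P| + (|∫ ω, U ω * A ω ∂P| + |∫ ω, U ω * B ω ∂P|) *
          (|∫ ω, V ω * A ω ∂P| + |∫ ω, V ω * B ω ∂P|)) := by
  have hnn : ∀ i, 0 ≤ absMoment i := absMoment_nonneg
  have step : ∀ k, ∃ D, 0 ≤ D ∧ ∀ (U V A B : Ω → ℝ) (g h : ℕ → ℝ → ℝ), GaussQuad P U V A B →
      DerivSeq M g → DerivSeq N h → |∫ ω, U ω * A ω ∂P| ≤ 1 → |∫ ω, U ω * B ω ∂P| ≤ 1 →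
      |∫ ω, U ω ^ (2 * k + 1) * V ω ^ (2 * l + 1) * g 0 (A ω) * h 0 (B ω) ∂P| ≤
        (2 * k : ℕ) * |∫ ω, U ω ^ (2 * k - 1) * V ω ^ (2 * l + 1) * g 0 (A ω) * h 0 (B ω) ∂P| +
        D * (|∫ ω, U ω * V ω ∂P| + (|∫ ω, U ω * A ω ∂P| + |∫ ω, U ω * B ω ∂P|) *
          (|∫ ω, V ω * A ω ∂P| + |∫ ω, V ω * B ω ∂P|)) := by
    intro k
    obtain ⟨C1, hC1, H1⟩ := exists_bound_odd_right (P := P) (2 * k) l (fun i => M (i + 1)) N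
    obtain ⟨C2, hC2, H2⟩ := exists_bound_odd_right (P := P) (2 * k) l M (fun i => N (i + 1))
    have k1 := hnn (2 * (2 * k))
    have k2 := hnn (2 * (2 * l))
    refine ⟨(2 * l + 1 : ℕ) * ((absMoment (2 * (2 * k)) + absMoment (2 * (2 * l))) * |M 0 * N 0|) +
      C1 + C2, by positivity, fun U V A B g h q hg hh hA hB => ?_⟩
    have e := q.integral_succ_pow hg hh (2 * k) (2 * l + 1) 0 0
    have t1 := q.abs_integral_le hg hh (2 * k) (2 * l) 0 0
    have t2 := H1 U V A B _ h q hg.shift hh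
    have t3 := H2 U V A B g _ q hg hh.shift
    simp only [zero_add, Nat.add_sub_cancel] at e t2 t3
    rw [e, abs_of_nonneg (mul_nonneg (hg.nonneg 0) (hh.nonneg 0))]
    have nM := mul_nonneg (hg.nonneg 0) (hh.nonneg 0)
    set r := ∫ ω, U ω * V ω ∂P
    set α := ∫ ω, U ω * A ω ∂P
    set β := ∫ ω, U ω * B ω ∂P
    set γ := ∫ ω, V ω * A ω ∂P
    set δ := ∫ ω, V ω * B ω ∂P
    set K := (absMoment (2 * (2 * k)) + absMoment (2 * (2 * l))) * (M 0 * N 0)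
    have hK : 0 ≤ K := by positivity
    have h4 : ∀ x y z w : ℝ, |x + y + z + w| ≤ |x| + |y| + |z| + |w| := fun x y z w =>
      (abs_add_le _ _).trans (by gcongr; exact abs_add_three _ _ _)
    refine (h4 _ _ _ _).trans ?_
    rw [abs_mul, abs_mul, abs_mul, abs_mul, abs_mul, Nat.abs_cast, Nat.abs_cast]
    have m1 := mul_le_mul_of_nonneg_left t1
      (mul_nonneg (Nat.cast_nonneg (α := ℝ) (2 * l + 1)) (abs_nonneg r))
    have m2 := mul_le_mul_of_nonneg_left t2 (abs_nonneg α)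
    have m3 := mul_le_mul_of_nonneg_left t3 (abs_nonneg β)
    have p1 : |α| * (C1 * (|r| + |γ| + |δ|)) ≤ C1 * (|r| + (|α| + |β|) * (|γ| + |δ|)) := by
      have : |α| * (|r| + |γ| + |δ|) ≤ |r| + (|α| + |β|) * (|γ| + |δ|) := by
        nlinarith [mul_le_mul_of_nonneg_right hA (abs_nonneg r),
          mul_nonneg (abs_nonneg β) (add_nonneg (abs_nonneg γ) (abs_nonneg δ))]
      calc _ = C1 * (|α| * (|r| + |γ| + |δ|)) := by ring
        _ ≤ _ := by gcongr
    have p2 : |β| * (C2 * (|r| + |γ| + |δ|)) ≤ C2 * (|r| + (|α| + |β|) * (|γ| + |δ|)) := by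
      have : |β| * (|r| + |γ| + |δ|) ≤ |r| + (|α| + |β|) * (|γ| + |δ|) := by
        nlinarith [mul_le_mul_of_nonneg_right hB (abs_nonneg r),
          mul_nonneg (abs_nonneg α) (add_nonneg (abs_nonneg γ) (abs_nonneg δ))]
      calc _ = C2 * (|β| * (|r| + |γ| + |δ|)) := by ring
        _ ≤ _ := by gcongr
    have p3 : (2 * l + 1 : ℕ) * |r| * K ≤
        (2 * l + 1 : ℕ) * K * (|r| + (|α| + |β|) * (|γ| + |δ|)) := by
      have : |r| ≤ |r| + (|α| + |β|) * (|γ| + |δ|) := le_add_of_nonneg_right (by positivity)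
      calc _ = (2 * l + 1 : ℕ) * K * |r| := by ring
        _ ≤ _ := by gcongr
    linarith
  induction k with
  | zero =>
    obtain ⟨D, hD, H⟩ := step 0
    refine ⟨D, hD, fun U V A B g h q hg hh hA hB => ?_⟩
    simpa using H U V A B g h q hg hh hA hB
  | succ k ih =>
    obtain ⟨C, hC, ih⟩ := ih
    obtain ⟨D, hD, H⟩ := step (k + 1)
    refine ⟨(2 * (k + 1) : ℕ) * C + D, by positivity, fun U V A B g h q hg hh hA hB => ?_⟩
    refine (H U V A B g h q hg hh hA hB).trans ?_
    have := mul_le_mul_of_nonneg_left (ih U V A B g h q hg hh hA hB)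
      (Nat.cast_nonneg (α := ℝ) (2 * (k + 1)))
    rw [show 2 * (k + 1) - 1 = 2 * k + 1 by omega]
    linarith

end GaussQuad

theorem abs_rpow_sub_abs_rpow_le {p : ℝ} (hp : 0 < p) (hp1 : p ≤ 1) (x y : ℝ) :
    |(|x| ^ p - |y| ^ p)| ≤ |x - y| ^ p := by
  have key : ∀ x y : ℝ, |x| ^ p - |y| ^ p ≤ |x - y| ^ p := by
    intro x y
    have h1 : |x| ^ p ≤ (|x - y| + |y|) ^ p :=
      Real.rpow_le_rpow (abs_nonneg _) (by simpa using abs_add_le (x - y) y) hp.le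
    have h2 := Real.rpow_add_le_add_rpow (abs_nonneg (x - y)) (abs_nonneg y) hp.le hp1
    linarith
  rw [abs_le]
  have := key y x
  rw [abs_sub_comm y x] at this
  exact ⟨by linarith, key x y⟩

/-- The odd extension of `x ↦ x ^ p`. -/
def signedPow (p x : ℝ) : ℝ := if 0 ≤ x then |x| ^ p else -|x| ^ p

theorem abs_sub_le_signedPow {p : ℝ} (hp : 0 < p) (i : ℤ) :
    |(|(i : ℝ) + 1| ^ p - |(i : ℝ)| ^ p)| ≤ signedPow p (i + 1) - signedPow p i := by
  unfold signedPow
  rcases le_or_gt 0 i with h | h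
  · have h' : (0 : ℝ) ≤ i := by exact_mod_cast h
    rw [if_pos (by linarith), if_pos h', abs_of_nonneg]
    exact sub_nonneg.2 (Real.rpow_le_rpow (abs_nonneg _)
      (by rw [abs_of_nonneg h', abs_of_nonneg (by linarith)]; linarith) hp.le)
  · have h' : (i : ℝ) + 1 ≤ 0 := by exact_mod_cast h
    have e : |(i : ℝ) + 1| ^ p ≤ |(i : ℝ)| ^ p := Real.rpow_le_rpow (abs_nonneg _)
      (by rw [abs_of_nonpos h', abs_of_nonpos (by linarith)]; linarith) hp.le
    rw [abs_of_nonpos (by linarith), if_neg (by linarith : ¬ (0 : ℝ) ≤ i)]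
    split_ifs with h2
    · have : (i : ℝ) + 1 = 0 := le_antisymm h' h2
      rw [this]
      simp [Real.zero_rpow hp.ne']
    · linarith

theorem sum_abs_rpow_sub_le {p : ℝ} (hp : 0 < p) {N k : ℕ} (hk : k ≤ N) :
    ∑ j ∈ Finset.range N, |(|(j : ℝ) + 1 - k| ^ p - |(j : ℝ) - k| ^ p)| ≤ 2 * (N : ℝ) ^ p := by
  have h : ∀ j : ℕ, |(|(j : ℝ) + 1 - k| ^ p - |(j : ℝ) - k| ^ p)| ≤
      signedPow p ((j + 1 : ℕ) - k) - signedPow p (j - k) := fun j => by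
    have := abs_sub_le_signedPow hp ((j : ℤ) - k)
    push_cast at this ⊢
    rwa [show (j : ℝ) + 1 - k = j - k + 1 by ring]
  refine (Finset.sum_le_sum fun j _ => h j).trans ?_
  rw [Finset.sum_range_sub (fun j : ℕ => signedPow p ((j : ℝ) - k))]
  have hk' : (k : ℝ) ≤ N := by exact_mod_cast hk
  have h0 : (0 : ℝ) ≤ k := by positivity
  have e1 : signedPow p ((N : ℝ) - k) ≤ (N : ℝ) ^ p := by
    rw [signedPow, if_pos (by linarith)]
    exact Real.rpow_le_rpow (abs_nonneg _) (by rw [abs_of_nonneg] <;> linarith) hp.le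
  have e2 : -signedPow p (((0 : ℕ) : ℝ) - k) ≤ (N : ℝ) ^ p := by
    have : |((0 : ℕ) : ℝ) - k| = k := by simp
    have h3 : (k : ℝ) ^ p ≤ (N : ℝ) ^ p := Real.rpow_le_rpow h0 hk' hp.le
    have h4 : 0 ≤ (k : ℝ) ^ p := by positivity
    rw [signedPow, this]
    split_ifs <;> linarith
  linarith

theorem rpow_second_diff_nonpos {p : ℝ} (hp : 0 ≤ p) (hp1 : p ≤ 1) {x : ℝ} (hx : 1 ≤ |x|) :
    |x + 1| ^ p + |x - 1| ^ p ≤ 2 * |x| ^ p := by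
  have key : ∀ x : ℝ, 1 ≤ x → |x + 1| ^ p + |x - 1| ^ p ≤ 2 * |x| ^ p := by
    intro x hx
    rw [abs_of_nonneg (by linarith), abs_of_nonneg (by linarith), abs_of_nonneg (by linarith)]
    have := (Real.concaveOn_rpow hp hp1).2
      (Set.mem_Ici.2 (by linarith : (0 : ℝ) ≤ x + 1)) (Set.mem_Ici.2 (by linarith : 0 ≤ x - 1))
      (by norm_num : (0 : ℝ) ≤ 1 / 2) (by norm_num : (0 : ℝ) ≤ 1 / 2) (by norm_num)
    simp only [smul_eq_mul] at this
    rw [show 1 / 2 * (x + 1) + 1 / 2 * (x - 1) = x by ring] at this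
    linarith
  rcases le_or_gt 0 x with h | h
  · exact key x (by rwa [abs_of_nonneg h] at hx)
  · have := key (-x) (by rwa [abs_of_neg h] at hx)
    rw [show -x + 1 = -(x - 1) by ring, show -x - 1 = -(x + 1) by ring, abs_neg, abs_neg,
      abs_neg] at this
    linarith

theorem sum_abs_second_diff_le {p : ℝ} (hp : 0 < p) (hp1 : p ≤ 1) (N j : ℕ) :
    ∑ k ∈ Finset.range N, |(|(j : ℝ) - k + 1| ^ p + |(j : ℝ) - k - 1| ^ p -
      2 * |(j : ℝ) - k| ^ p)| ≤ 10 := by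
  let W : ℤ → ℝ := fun i => -(|(i : ℝ) + 1| ^ p - |(i : ℝ)| ^ p) + if 0 ≤ i then 4 else 0
  have hW : ∀ i : ℤ, |(|(i : ℝ) + 1| ^ p + |(i : ℝ) - 1| ^ p - 2 * |(i : ℝ)| ^ p)| ≤
      W i - W (i - 1) := by
    intro i
    simp only [W, Int.cast_sub, Int.cast_one, sub_add_cancel]
    rcases eq_or_ne i 0 with rfl | hi
    · simp [Real.zero_rpow hp.ne']
      norm_num
    · have h1 : (1 : ℝ) ≤ |(i : ℝ)| := by exact_mod_cast Int.one_le_abs hi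
      have := rpow_second_diff_nonpos hp.le hp1 h1
      rw [abs_of_nonpos (by linarith)]
      have : (if 0 ≤ i then (4 : ℝ) else 0) = if 0 ≤ i - 1 then 4 else 0 := by
        congr 1
        simp only [eq_iff_iff]
        omega
      rw [this]
      linarith
  have hB : ∀ i, -1 ≤ W i ∧ W i ≤ 5 := by
    intro i
    have := abs_rpow_sub_abs_rpow_le hp hp1 ((i : ℝ) + 1) i
    rw [add_sub_cancel_left, abs_one, Real.one_rpow, abs_le] at this
    simp only [W]
    split_ifs <;> constructor <;> linarith
  have h : ∀ k : ℕ, |(|(j : ℝ) - k + 1| ^ p + |(j : ℝ) - k - 1| ^ p - 2 * |(j : ℝ) - k| ^ p)| ≤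
      W (j - k) - W (j - (k + 1 : ℕ)) := fun k => by
    have := hW (j - k)
    rw [sub_sub] at this
    exact_mod_cast this
  refine (Finset.sum_le_sum fun k _ => h k).trans ?_
  rw [Finset.sum_range_sub' (fun k : ℕ => W ((j : ℤ) - k))]
  have := (hB ((j : ℤ) - (0 : ℕ))).2
  have := (hB ((j : ℤ) - N)).1
  linarith

section grid
variable {H : ℝ}

theorem covH_mul (δ : ℝ) (hδ : 0 ≤ δ) (s t : ℝ) :
    covH H (s * δ) (t * δ) = δ ^ (2 * H) * covH H s t := by
  unfold covH
  rw [← sub_mul, abs_mul, abs_mul, abs_mul, abs_of_nonneg hδ,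
    Real.mul_rpow (abs_nonneg _) hδ, Real.mul_rpow (abs_nonneg _) hδ,
    Real.mul_rpow (abs_nonneg _) hδ]
  ring

theorem covH_comm (s t : ℝ) : covH H s t = covH H t s := by
  unfold covH
  rw [abs_sub_comm]
  ring

theorem covH_incr_self (hH : 0 < H) (s : ℝ) :
    covH H (s + 1) (s + 1) - 2 * covH H (s + 1) s + covH H s s = 1 := by
  unfold covH
  have : (2 * H) ≠ 0 := by positivity
  simp [Real.zero_rpow this]
  ring

theorem abs_covH_sub_le (hH : 0 < H) (hH1 : H ≤ 1 / 2) (s t : ℝ) :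
    |covH H (s + 1) t - covH H s t| ≤ 1 := by
  have h1 := abs_rpow_sub_abs_rpow_le (p := 2 * H) (by linarith) (by linarith) (s + 1) s
  have h2 := abs_rpow_sub_abs_rpow_le (p := 2 * H) (by linarith) (by linarith) (s + 1 - t) (s - t)
  rw [add_sub_cancel_left, abs_one, Real.one_rpow, abs_le] at h1
  rw [show s + 1 - t - (s - t) = 1 by ring, abs_one, Real.one_rpow, abs_le] at h2
  unfold covH
  rw [abs_le]
  constructor <;> linarith

theorem sum_abs_covH_sub_le (hH : 0 < H) {N k : ℕ} (hk : k ≤ N) :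
    ∑ j ∈ Finset.range N, |covH H ((j : ℝ) + 1) k - covH H j k| ≤ 2 * (N : ℝ) ^ (2 * H) := by
  have h1 := sum_abs_rpow_sub_le (p := 2 * H) (by linarith) hk
  have h0 := sum_abs_rpow_sub_le (p := 2 * H) (k := 0) (by linarith) (Nat.zero_le N)
  have h : ∀ j : ℕ, |covH H ((j : ℝ) + 1) k - covH H j k| ≤
      1 / 2 * |(|(j : ℝ) + 1 - (0 : ℕ)| ^ (2 * H) - |(j : ℝ) - (0 : ℕ)| ^ (2 * H))| +
      1 / 2 * |(|(j : ℝ) + 1 - k| ^ (2 * H) - |(j : ℝ) - k| ^ (2 * H))| := by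
    intro j
    simp only [Nat.cast_zero, sub_zero]
    have tri : ∀ a b c d e : ℝ, |(a + e - b) / 2 - (c + e - d) / 2| ≤
        1 / 2 * |a - c| + 1 / 2 * |b - d| := fun a b c d e => by
      rw [abs_le]
      have h1 := abs_le.1 (le_refl |a - c|)
      have h2 := abs_le.1 (le_refl |b - d|)
      constructor <;> linarith
    exact tri _ _ _ _ _
  refine (Finset.sum_le_sum fun j _ => h j).trans ?_
  rw [Finset.sum_add_distrib, ← Finset.mul_sum, ← Finset.mul_sum]
  refine (add_le_add (mul_le_mul_of_nonneg_left h0 (by norm_num))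
    (mul_le_mul_of_nonneg_left h1 (by norm_num))).trans (le_of_eq (by ring))

theorem sum_abs_covH_second_diff_le (hH : 0 < H) (hH1 : H ≤ 1 / 2) (N j : ℕ) :
    ∑ k ∈ Finset.range N, |covH H ((j : ℝ) + 1) ((k : ℝ) + 1) - covH H ((j : ℝ) + 1) k -
      (covH H j ((k : ℝ) + 1) - covH H j k)| ≤ 5 := by
  have h := sum_abs_second_diff_le (p := 2 * H) (by linarith) (by linarith) N j
  have e : ∀ k : ℕ, |covH H ((j : ℝ) + 1) ((k : ℝ) + 1) - covH H ((j : ℝ) + 1) k -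
      (covH H j ((k : ℝ) + 1) - covH H j k)| =
      |(|(j : ℝ) - k + 1| ^ (2 * H) + |(j : ℝ) - k - 1| ^ (2 * H) -
      2 * |(j : ℝ) - k| ^ (2 * H))| / 2 := by
    intro k
    rw [← abs_two (α := ℝ), ← abs_div, abs_two]
    unfold covH
    congr 1
    rw [show (j : ℝ) + 1 - (k + 1) = j - k by ring, show (j : ℝ) + 1 - k = j - k + 1 by ring,
      show (j : ℝ) - (k + 1) = j - k - 1 by ring]
    ring
  simp only [e, ← Finset.sum_div]
  linarith

end grid

/-- Increment of `X` over the `j`-th cell of the grid of mesh `δ`. -/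
def gridIncr (X : ℝ → Ω → ℝ) (δ : ℝ) (j : ℕ) (ω : Ω) : ℝ :=
  X (((j : ℝ) + 1) * δ) ω - X (j * δ) ω

/-- Average of `X` over the endpoints of the `j`-th cell of the grid of mesh `δ`. -/
def gridMid (X : ℝ → Ω → ℝ) (δ : ℝ) (j : ℕ) (ω : Ω) : ℝ :=
  (X (((j : ℝ) + 1) * δ) ω + X (j * δ) ω) / 2

section fbm
variable [MeasurableSpace Ω] {P : Measure Ω} {X : ℝ → Ω → ℝ} {H δ : ℝ}

theorem covH_self (hH : 0 < H) (s : ℝ) : covH H s s = |s| ^ (2 * H) := by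
  have : (2 * H) ≠ 0 := by positivity
  simp [covH, Real.zero_rpow this]

namespace IsCenteredGaussianProcess

theorem measurable (hX : IsCenteredGaussianProcess P X (covH H)) (t : ℝ) : Measurable (X t) :=
  hX.1 t

theorem measurable_gridIncr (hX : IsCenteredGaussianProcess P X (covH H)) (j : ℕ) :
    Measurable (gridIncr X δ j) := (hX.1 _).sub (hX.1 _)

theorem measurable_gridMid (hX : IsCenteredGaussianProcess P X (covH H)) (j : ℕ) :
    Measurable (gridMid X δ j) := ((hX.1 _).add (hX.1 _)).div_const 2

theorem map_two (hX : IsCenteredGaussianProcess P X (covH H)) (a b s t : ℝ) :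
    P.map (fun ω => a * X s ω + b * X t ω) = gaussianReal 0
      (Real.toNNReal (a ^ 2 * covH H s s + 2 * a * b * covH H s t + b ^ 2 * covH H t t)) := by
  have := hX.2 2 ![s, t] ![a, b]
  simp only [Fin.sum_univ_two, Matrix.cons_val_zero, Matrix.cons_val_one] at this
  rw [this, covH_comm t s]
  congr 2
  ring

theorem hasGaussianLaw_four [IsProbabilityMeasure P]
    (hX : IsCenteredGaussianProcess P X (covH H)) (s t u v : ℝ) :
    HasGaussianLaw (fun ω => (X s ω, X t ω, X u ω, X v ω)) P := by
  have hm : Measurable fun ω => (X s ω, X t ω, X u ω, X v ω) :=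
    (hX.1 s).prodMk ((hX.1 t).prodMk ((hX.1 u).prodMk (hX.1 v)))
  refine ⟨isGaussian_of_map_eq_gaussianReal fun L => ?_⟩
  have h4 := hX.2 4 ![s, t, u, v] ![L (1, 0, 0, 0), L (0, 1, 0, 0), L (0, 0, 1, 0), L (0, 0, 0, 1)]
  refine ⟨_, _, Eq.trans ?_ h4⟩
  · rw [Measure.map_map L.continuous.measurable hm]
    congr 1
    ext ω
    simp only [Function.comp_apply, Fin.sum_univ_four, Matrix.cons_val]
    have : (X s ω, X t ω, X u ω, X v ω) = X s ω • ((1, 0, 0, 0) : ℝ × ℝ × ℝ × ℝ) +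
        X t ω • ((0, 1, 0, 0) : ℝ × ℝ × ℝ × ℝ) + X u ω • ((0, 0, 1, 0) : ℝ × ℝ × ℝ × ℝ) +
        X v ω • ((0, 0, 0, 1) : ℝ × ℝ × ℝ × ℝ) := by simp
    rw [this, map_add, map_add, map_add, map_smul, map_smul, map_smul, map_smul]
    simp only [smul_eq_mul]
    ring

theorem memLp_two [IsProbabilityMeasure P] (hX : IsCenteredGaussianProcess P X (covH H)) (s : ℝ) :
    MemLp (X s) 2 P := (hX.hasGaussianLaw_four s s s s).fst.memLp_two

theorem integral_eq_zero (hX : IsCenteredGaussianProcess P X (covH H)) (s : ℝ) :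
    ∫ ω, X s ω ∂P = 0 := by
  have h := hX.map_two 1 0 s s
  simp only [one_mul, zero_mul, add_zero] at h
  have := integral_map (μ := P) (hX.1 s).aemeasurable (f := fun x : ℝ => x) (by fun_prop)
  rw [← this, h]
  exact integral_id_gaussianReal

theorem integral_sq_of_map {Y : Ω → ℝ} (mY : Measurable Y) {v : NNReal}
    (h : P.map Y = gaussianReal 0 v) : ∫ ω, Y ω ^ 2 ∂P = v := by
  have h2 := variance_id_gaussianReal (μ := 0) (v := v)
  rw [variance_eq_sub (memLp_id_gaussianReal 2)] at h2
  simp only [id, integral_id_gaussianReal, Pi.pow_apply] at h2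
  rw [← h, integral_map mY.aemeasurable (by fun_prop)] at h2
  simpa using h2

theorem integral_mul [IsProbabilityMeasure P] (hH : 0 < H)
    (hX : IsCenteredGaussianProcess P X (covH H)) (s t : ℝ) :
    ∫ ω, X s ω * X t ω ∂P = covH H s t := by
  have h1 := hX.map_two 1 0 s s
  have h2 := hX.map_two 1 0 t t
  have h3 := hX.map_two 1 (-1) s t
  have mm : ∀ a b s t, Measurable fun ω => a * X s ω + b * X t ω := fun a b s t =>
    ((hX.1 s).const_mul a).add ((hX.1 t).const_mul b)
  have e1 := integral_sq_of_map (mm 1 0 s s) h1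
  have e2 := integral_sq_of_map (mm 1 0 t t) h2
  have e3 := integral_sq_of_map (mm 1 (-1) s t) h3
  have c3 : (1 : ℝ) ^ 2 * covH H s s + 2 * 1 * (-1) * covH H s t + (-1) ^ 2 * covH H t t =
      |s - t| ^ (2 * H) := by
    rw [covH_self hH, covH_self hH, covH]
    ring
  rw [c3, Real.coe_toNNReal _ (by positivity)] at e3
  simp only [one_mul, zero_mul, add_zero, one_pow, mul_zero, zero_pow two_ne_zero,
    covH_self hH] at e1 e2
  rw [Real.coe_toNNReal _ (by positivity)] at e1 e2
  have I1 := (hX.memLp_two s).integrable_sq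
  have I2 := (hX.memLp_two t).integrable_sq
  have I3 : Integrable (fun ω => (1 * X s ω + -1 * X t ω) ^ 2) P :=
    (((hX.memLp_two s).const_mul 1).add ((hX.memLp_two t).const_mul (-1))).integrable_sq
  have := GaussQuad.integral_four_mul I1 I2 I3 I3 (1 / 2) (1 / 2) (-(1 / 2)) 0
  rw [e1, e2, e3] at this
  calc _ = _ := by congr 1; ext ω; ring
    _ = _ := this
    _ = _ := by rw [covH]; ring

theorem integral_comb [IsProbabilityMeasure P] (hH : 0 < H)
    (hX : IsCenteredGaussianProcess P X (covH H)) (a b c d s t u v : ℝ) :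
    ∫ ω, (a * X s ω + b * X t ω) * (c * X u ω + d * X v ω) ∂P =
      a * c * covH H s u + a * d * covH H s v + b * c * covH H t u + b * d * covH H t v := by
  have I : ∀ s t, Integrable (fun ω => X s ω * X t ω) P := fun s t =>
    (hX.memLp_two s).integrable_mul (hX.memLp_two t)
  have := GaussQuad.integral_four_mul (I s u) (I s v) (I t u) (I t v) (a * c) (a * d) (b * c)
    (b * d)
  rw [hX.integral_mul hH, hX.integral_mul hH, hX.integral_mul hH, hX.integral_mul hH] at this
  rw [← this]
  congr 1; ext ω; ring

theorem ae_eq_zero (hH : 0 < H) (hX : IsCenteredGaussianProcess P X (covH H)) :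
    ∀ᵐ ω ∂P, X 0 ω = 0 := by
  have h := hX.map_two 1 0 0 0
  have : (2 * H) ≠ 0 := by positivity
  simp only [one_mul, zero_mul, add_zero, one_pow, mul_zero, zero_pow two_ne_zero,
    covH_self hH, abs_zero, Real.zero_rpow this, Real.toNNReal_zero, gaussianReal_zero_var] at h
  have h2 : ∀ᵐ x ∂(P.map (X 0)), x = 0 := by
    rw [h]
    exact (ae_dirac_iff (measurableSet_singleton 0)).2 rfl
  exact ae_of_ae_map (hX.1 0).aemeasurable h2

theorem map_gridIncr (hH : 0 < H) (hδ : 0 < δ) (hX : IsCenteredGaussianProcess P X (covH H))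
    (j : ℕ) : P.map (fun ω => gridIncr X δ j ω / δ ^ H) = gaussianReal 0 1 := by
  have h := hX.map_two (1 / δ ^ H) (-(1 / δ ^ H)) (((j : ℝ) + 1) * δ) (j * δ)
  have hp : 0 < δ ^ H := Real.rpow_pos_of_pos hδ H
  have e : (1 / δ ^ H) ^ 2 * covH H (((j : ℝ) + 1) * δ) (((j : ℝ) + 1) * δ) +
      2 * (1 / δ ^ H) * (-(1 / δ ^ H)) * covH H (((j : ℝ) + 1) * δ) (j * δ) +
      (-(1 / δ ^ H)) ^ 2 * covH H (j * δ) (j * δ) = 1 := by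
    rw [covH_mul _ hδ.le, covH_mul _ hδ.le, covH_mul _ hδ.le]
    have h1 := covH_incr_self hH (j : ℝ)
    have h2 : δ ^ (2 * H) = (δ ^ H) ^ 2 := by
      rw [mul_comm, Real.rpow_mul hδ.le]; norm_num
    rw [h2]
    field_simp
    linear_combination h1
  rw [e, Real.toNNReal_one] at h
  rw [← h]
  congr 1
  ext ω
  rw [gridIncr]
  ring

theorem gaussQuad [IsProbabilityMeasure P] (hH : 0 < H) (hδ : 0 < δ)
    (hX : IsCenteredGaussianProcess P X (covH H)) (j k : ℕ) :
    GaussQuad P (fun ω => gridIncr X δ j ω / δ ^ H) (fun ω => gridIncr X δ k ω / δ ^ H)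
      (gridMid X δ j) (gridMid X δ k) where
  law := by
    have h := hX.hasGaussianLaw_four (((j : ℝ) + 1) * δ) (j * δ) (((k : ℝ) + 1) * δ) (k * δ)
    let p1 := ContinuousLinearMap.fst ℝ ℝ (ℝ × ℝ × ℝ)
    let r1 := ContinuousLinearMap.snd ℝ ℝ (ℝ × ℝ × ℝ)
    let p2 := (ContinuousLinearMap.fst ℝ ℝ (ℝ × ℝ)).comp r1
    let r2 := (ContinuousLinearMap.snd ℝ ℝ (ℝ × ℝ)).comp r1
    let p3 := (ContinuousLinearMap.fst ℝ ℝ ℝ).comp r2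
    let p4 := (ContinuousLinearMap.snd ℝ ℝ ℝ).comp r2
    have := h.map_fun (((δ ^ H)⁻¹ • (p1 - p2)).prod (((δ ^ H)⁻¹ • (p3 - p4)).prod
      (((2 : ℝ)⁻¹ • (p1 + p2)).prod ((2 : ℝ)⁻¹ • (p3 + p4)))))
    refine this.congr (Eventually.of_forall fun ω => ?_)
    simp [p1, p2, p3, p4, r1, r2, gridIncr, gridMid, div_eq_inv_mul, mul_add]
  mU := (hX.measurable_gridIncr j).div_const _
  mV := (hX.measurable_gridIncr k).div_const _
  mA := hX.measurable_gridMid j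
  mB := hX.measurable_gridMid k
  lawU := hX.map_gridIncr hH hδ j
  lawV := hX.map_gridIncr hH hδ k
  meanA := by
    unfold gridMid
    rw [integral_div, integral_add ((hX.memLp_two _).integrable one_le_two)
      ((hX.memLp_two _).integrable one_le_two), hX.integral_eq_zero, hX.integral_eq_zero]
    simp
  meanB := by
    unfold gridMid
    rw [integral_div, integral_add ((hX.memLp_two _).integrable one_le_two)
      ((hX.memLp_two _).integrable one_le_two), hX.integral_eq_zero, hX.integral_eq_zero]
    simp

theorem integral_gridIncr_mul [IsProbabilityMeasure P] (hH : 0 < H) (hδ : 0 < δ)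
    (hX : IsCenteredGaussianProcess P X (covH H)) (j k : ℕ) :
    ∫ ω, gridIncr X δ j ω / δ ^ H * (gridIncr X δ k ω / δ ^ H) ∂P =
      covH H ((j : ℝ) + 1) ((k : ℝ) + 1) - covH H ((j : ℝ) + 1) k -
      (covH H j ((k : ℝ) + 1) - covH H j k) := by
  have h := hX.integral_comb hH (1 / δ ^ H) (-(1 / δ ^ H)) (1 / δ ^ H) (-(1 / δ ^ H))
    (((j : ℝ) + 1) * δ) (j * δ) (((k : ℝ) + 1) * δ) (k * δ)
  have hp : 0 < δ ^ H := Real.rpow_pos_of_pos hδ H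
  have h2 : δ ^ (2 * H) = (δ ^ H) ^ 2 := by
    rw [mul_comm, Real.rpow_mul hδ.le]; norm_num
  rw [covH_mul _ hδ.le, covH_mul _ hδ.le, covH_mul _ hδ.le, covH_mul _ hδ.le, h2] at h
  calc _ = _ := by congr 1; ext ω; unfold gridIncr; ring
    _ = _ := h
    _ = _ := by field_simp; ring

theorem integral_gridIncr_mul_gridMid [IsProbabilityMeasure P] (hH : 0 < H) (hδ : 0 < δ)
    (hX : IsCenteredGaussianProcess P X (covH H)) (j k : ℕ) :
    ∫ ω, gridIncr X δ j ω / δ ^ H * gridMid X δ k ω ∂P =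
      δ ^ H * ((covH H ((j : ℝ) + 1) (k + 1 : ℕ) - covH H j (k + 1 : ℕ)) +
      (covH H ((j : ℝ) + 1) k - covH H j k)) / 2 := by
  have h := hX.integral_comb hH (1 / δ ^ H) (-(1 / δ ^ H)) (1 / 2) (1 / 2)
    (((j : ℝ) + 1) * δ) (j * δ) (((k : ℝ) + 1) * δ) (k * δ)
  have hp : 0 < δ ^ H := Real.rpow_pos_of_pos hδ H
  have h2 : δ ^ (2 * H) = (δ ^ H) ^ 2 := by
    rw [mul_comm, Real.rpow_mul hδ.le]; norm_num
  rw [covH_mul _ hδ.le, covH_mul _ hδ.le, covH_mul _ hδ.le, covH_mul _ hδ.le, h2] at h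
  push_cast
  calc _ = _ := by congr 1; ext ω; unfold gridIncr gridMid; ring
    _ = _ := h
    _ = _ := by field_simp; ring

end IsCenteredGaussianProcess

theorem IndepProcesses.indepFun {X1 X2 : ℝ → Ω → ℝ} (h : IndepProcesses P X1 X2) {E F : Type*}
    [MeasurableSpace E] [MeasurableSpace F] {Y : Ω → E} {Z : Ω → F}
    (hY : Measurable[⨆ t : ℝ, MeasurableSpace.comap (X1 t) inferInstance] Y)
    (hZ : Measurable[⨆ t : ℝ, MeasurableSpace.comap (X2 t) inferInstance] Z) :
    IndepFun Y Z P := by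
  rw [IndepFun_iff_Indep]
  exact indep_of_indep_of_le h hY.comap_le hZ.comap_le

theorem IndepProcesses.symm {X1 X2 : ℝ → Ω → ℝ} (h : IndepProcesses P X1 X2) :
    IndepProcesses P X2 X1 := Indep.symm h

end fbm

theorem measurable_quad_iSup_comap (X : ℝ → Ω → ℝ) (δ σ : ℝ) (j k : ℕ) :
    Measurable[⨆ t : ℝ, MeasurableSpace.comap (X t) inferInstance]
      (fun ω => (gridIncr X δ j ω / σ, gridIncr X δ k ω / σ, gridMid X δ j ω, gridMid X δ k ω)) := by
  have hX : ∀ t, Measurable[⨆ t : ℝ, MeasurableSpace.comap (X t) inferInstance] (X t) := fun t =>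
    measurable_iff_comap_le.2 (le_iSup (fun t => MeasurableSpace.comap (X t) inferInstance) t)
  have h1 : ∀ j, Measurable[⨆ t : ℝ, MeasurableSpace.comap (X t) inferInstance]
      (fun ω => gridIncr X δ j ω / σ) := fun j => ((hX _).sub (hX _)).div_const _
  have h2 : ∀ j, Measurable[⨆ t : ℝ, MeasurableSpace.comap (X t) inferInstance]
      (gridMid X δ j) := fun j => ((hX _).add (hX _)).div_const _
  exact (h1 j).prodMk ((h1 k).prodMk ((h2 j).prodMk (h2 k)))

/-- `G i` is the `i`-th partial derivative of the continuous function `G 0` in its first variable,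
bounded by `M i`. -/
structure PartialDerivSeq (M : ℕ → ℝ) (G : ℕ → ℝ → ℝ → ℝ) : Prop where
  cont : Continuous (Function.uncurry (G 0))
  seq : ∀ y, DerivSeq M fun i x => G i x y

section pair
variable [MeasurableSpace Ω] {P : Measure Ω}

theorem integrable_pair [IsProbabilityMeasure P] {U V A B U' V' A' B' : Ω → ℝ}
    (q : GaussQuad P U V A B) (q' : GaussQuad P U' V' A' B')
    (hI : IndepFun (fun ω => (U ω, V ω, A ω, B ω)) (fun ω => (U' ω, V' ω, A' ω, B' ω)) P)
    {M : ℕ → ℝ} {G : ℕ → ℝ → ℝ → ℝ} (hG : PartialDerivSeq M G) (a b : ℕ) :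
    Integrable (fun ω => (U ω ^ a * U' ω ^ b * G 0 (A ω) (A' ω)) *
      (V ω ^ a * V' ω ^ b * G 0 (B ω) (B' ω))) P := by
  have m := q.mU
  have m2 := q.mV
  have m3 := q.mA
  have m4 := q.mB
  have m' := q'.mU
  have m2' := q'.mV
  have m3' := q'.mA
  have m4' := q'.mB
  have hA : Measurable fun ω => G 0 (A ω) (A' ω) := hG.cont.measurable.comp (m3.prodMk m3')
  have hB : Measurable fun ω => G 0 (B ω) (B' ω) := hG.cont.measurable.comp (m4.prodMk m4')
  have hI' : IndepFun (fun ω => |U ω| ^ a * |V ω| ^ a) (fun ω => |U' ω| ^ b * |V' ω| ^ b) P :=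
    hI.comp (φ := fun x : ℝ × ℝ × ℝ × ℝ => |x.1| ^ a * |x.2.1| ^ a)
      (ψ := fun x : ℝ × ℝ × ℝ × ℝ => |x.1| ^ b * |x.2.1| ^ b) (by fun_prop) (by fun_prop)
  have := (hI'.integrable_mul (integrable_abs_pow_mul q.mU q.lawU q.mV q.lawV a a)
    (integrable_abs_pow_mul q'.mU q'.lawU q'.mV q'.lawV b b)).mul_const (M 0 * M 0)
  refine this.mono' ((((m.pow_const a).mul (m'.pow_const b)).mul hA).mul
    (((m2.pow_const a).mul (m2'.pow_const b)).mul hB)).aestronglyMeasurable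
    (Eventually.of_forall fun ω => ?_)
  have b1 := (hG.seq (A' ω)).bound 0 (A ω)
  have b2 := (hG.seq (B' ω)).bound 0 (B ω)
  have b3 := (hG.seq (B' ω)).nonneg 0
  rw [Real.norm_eq_abs]
  simp only [abs_mul, abs_pow, Pi.mul_apply]
  calc _ = |U ω| ^ a * |V ω| ^ a * (|U' ω| ^ b * |V' ω| ^ b) *
        (|G 0 (A ω) (A' ω)| * |G 0 (B ω) (B' ω)|) := by ring
    _ ≤ _ := by gcongr

theorem exists_pair_bound [IsProbabilityMeasure P] (k b : ℕ) (M : ℕ → ℝ) :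
    ∃ C, 0 ≤ C ∧ ∀ (U V A B U' V' A' B' : Ω → ℝ) (G : ℕ → ℝ → ℝ → ℝ), GaussQuad P U V A B →
      GaussQuad P U' V' A' B' →
      IndepFun (fun ω => (U ω, V ω, A ω, B ω)) (fun ω => (U' ω, V' ω, A' ω, B' ω)) P →
      PartialDerivSeq M G → |∫ ω, U ω * A ω ∂P| ≤ 1 → |∫ ω, U ω * B ω ∂P| ≤ 1 →
      ∫ ω, (U ω ^ (2 * k + 1) * U' ω ^ b * G 0 (A ω) (A' ω)) *
        (V ω ^ (2 * k + 1) * V' ω ^ b * G 0 (B ω) (B' ω)) ∂P ≤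
        C * (|∫ ω, U ω * V ω ∂P| + (|∫ ω, U ω * A ω ∂P| + |∫ ω, U ω * B ω ∂P|) *
          (|∫ ω, V ω * A ω ∂P| + |∫ ω, V ω * B ω ∂P|)) := by
  obtain ⟨C, hC, hb⟩ := GaussQuad.exists_bound_odd_odd (P := P) k k M M
  have hm := absMoment_nonneg (2 * b)
  refine ⟨(absMoment (2 * b) + absMoment (2 * b)) * C, by positivity, ?_⟩
  intro U V A B U' V' A' B' G q q' hI hG hA hB
  let F : ℝ × ℝ × ℝ × ℝ → ℝ × ℝ × ℝ × ℝ → ℝ := fun x y =>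
    (x.1 ^ (2 * k + 1) * y.1 ^ b * G 0 x.2.2.1 y.2.2.1) *
      (x.2.1 ^ (2 * k + 1) * y.2.1 ^ b * G 0 x.2.2.2 y.2.2.2)
  have hF : Measurable (Function.uncurry F) := by
    have c1 : Continuous fun p : (ℝ × ℝ × ℝ × ℝ) × ℝ × ℝ × ℝ × ℝ =>
        G 0 p.1.2.2.1 p.2.2.2.1 :=
      hG.cont.comp (f := fun p : (ℝ × ℝ × ℝ × ℝ) × ℝ × ℝ × ℝ × ℝ =>
        (p.1.2.2.1, p.2.2.2.1)) (by fun_prop)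
    have c2 : Continuous fun p : (ℝ × ℝ × ℝ × ℝ) × ℝ × ℝ × ℝ × ℝ =>
        G 0 p.1.2.2.2 p.2.2.2.2 :=
      hG.cont.comp (f := fun p : (ℝ × ℝ × ℝ × ℝ) × ℝ × ℝ × ℝ × ℝ =>
        (p.1.2.2.2, p.2.2.2.2)) (by fun_prop)
    have d1 : Continuous fun p : (ℝ × ℝ × ℝ × ℝ) × ℝ × ℝ × ℝ × ℝ =>
        p.1.1 ^ (2 * k + 1) * p.2.1 ^ b := by fun_prop
    have d2 : Continuous fun p : (ℝ × ℝ × ℝ × ℝ) × ℝ × ℝ × ℝ × ℝ =>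
        p.1.2.1 ^ (2 * k + 1) * p.2.2.1 ^ b := by fun_prop
    exact ((d1.mul c1).mul (d2.mul c2)).measurable
  set e := |∫ ω, U ω * V ω ∂P| + (|∫ ω, U ω * A ω ∂P| + |∫ ω, U ω * B ω ∂P|) *
          (|∫ ω, V ω * A ω ∂P| + |∫ ω, V ω * B ω ∂P|) with he
  have he0 : 0 ≤ e := by positivity
  have hY : Measurable fun ω => (U ω, V ω, A ω, B ω) :=
    q.mU.prodMk (q.mV.prodMk (q.mA.prodMk q.mB))
  have hY' : Measurable fun ω => (U' ω, V' ω, A' ω, B' ω) :=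
    q'.mU.prodMk (q'.mV.prodMk (q'.mA.prodMk q'.mB))
  have key := (IndepFun.integral_comp_prod hY hY' hI hF
    (integrable_pair q q' hI hG (2 * k + 1) b)).1
  simp only [F] at key
  rw [key]
  have inner : ∀ ω', |∫ ω, (U ω ^ (2 * k + 1) * U' ω' ^ b * G 0 (A ω) (A' ω')) *
      (V ω ^ (2 * k + 1) * V' ω' ^ b * G 0 (B ω) (B' ω')) ∂P| ≤
      |U' ω'| ^ b * |V' ω'| ^ b * (C * e) := by
    intro ω'
    have h := hb U V A B _ _ q (hG.seq (A' ω')) (hG.seq (B' ω')) hA hB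
    have e1 : ∫ ω, (U ω ^ (2 * k + 1) * U' ω' ^ b * G 0 (A ω) (A' ω')) *
      (V ω ^ (2 * k + 1) * V' ω' ^ b * G 0 (B ω) (B' ω')) ∂P = U' ω' ^ b * V' ω' ^ b *
      ∫ ω, U ω ^ (2 * k + 1) * V ω ^ (2 * k + 1) * G 0 (A ω) (A' ω') * G 0 (B ω) (B' ω') ∂P := by
      rw [← integral_const_mul]
      congr 1; ext ω; ring
    rw [e1, abs_mul, abs_mul, abs_pow, abs_pow]
    gcongr
  refine (le_abs_self _).trans ?_
  have outer := norm_integral_le_of_norm_le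
    ((integrable_abs_pow_mul q'.mU q'.lawU q'.mV q'.lawV b b).mul_const (C * e))
    (Eventually.of_forall fun ω' => (Real.norm_eq_abs _).trans_le (inner ω'))
  rw [Real.norm_eq_abs] at outer
  refine outer.trans ?_
  rw [integral_mul_const, mul_assoc]
  exact mul_le_mul_of_nonneg_right (integral_abs_pow_mul_le q'.mU q'.lawU q'.mV q'.lawV b b)
    (by positivity)

end pair

section sums
variable {H : ℝ}

theorem sum_abs_covH_diag_sub_le (hH : 0 < H) (N : ℕ) :
    ∑ j ∈ Finset.range N, |covH H ((j : ℝ) + 1) ((j : ℝ) + 1) - covH H j j| ≤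
      2 * (N : ℝ) ^ (2 * H) := by
  have h0 := sum_abs_rpow_sub_le (p := 2 * H) (k := 0) (by linarith) (Nat.zero_le N)
  simpa only [covH_self hH, Nat.cast_zero, sub_zero] using h0

end sums

section l2
variable [MeasurableSpace Ω] {P : Measure Ω} {X Y : ℝ → Ω → ℝ} {H δ : ℝ}

theorem IsCenteredGaussianProcess.abs_integral_gridIncr_mul_gridMid_le [IsProbabilityMeasure P]
    (hH : 0 < H) (hH1 : H ≤ 1 / 2) (hδ : 0 < δ) (hX : IsCenteredGaussianProcess P X (covH H))
    (j k : ℕ) : |∫ ω, gridIncr X δ j ω / δ ^ H * gridMid X δ k ω ∂P| ≤ δ ^ H := by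
  have hp : 0 < δ ^ H := Real.rpow_pos_of_pos hδ H
  rw [hX.integral_gridIncr_mul_gridMid hH hδ, mul_div_assoc, abs_mul, abs_of_pos hp]
  have h1 := abs_le.1 (abs_covH_sub_le hH hH1 j (k + 1 : ℕ))
  have h2 := abs_le.1 (abs_covH_sub_le hH hH1 j k)
  refine mul_le_of_le_one_right hp.le (abs_le.2 ⟨?_, ?_⟩) <;> linarith

/-- The bound on the `(j, k)` entry of the second moment of the weighted odd power variation. -/
def pairErr (P : Measure Ω) (X : ℝ → Ω → ℝ) (H δ : ℝ) (j k : ℕ) : ℝ :=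
  |∫ ω, gridIncr X δ j ω / δ ^ H * (gridIncr X δ k ω / δ ^ H) ∂P| +
    (|∫ ω, gridIncr X δ j ω / δ ^ H * gridMid X δ j ω ∂P| +
      |∫ ω, gridIncr X δ j ω / δ ^ H * gridMid X δ k ω ∂P|) *
    (|∫ ω, gridIncr X δ k ω / δ ^ H * gridMid X δ j ω ∂P| +
      |∫ ω, gridIncr X δ k ω / δ ^ H * gridMid X δ k ω ∂P|)

theorem IsCenteredGaussianProcess.sum_pairErr_le [IsProbabilityMeasure P]
    (hH : 0 < H) (hH1 : H ≤ 1 / 2) (hδ : 0 < δ) (hX : IsCenteredGaussianProcess P X (covH H))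
    {N : ℕ} {T : ℝ} (hN : N * δ ≤ T) :
    ∑ j ∈ Finset.range N, ∑ k ∈ Finset.range N, pairErr P X H δ j k ≤
      N * (5 + 6 * T ^ (2 * H)) := by
  have hp : 0 < δ ^ H := Real.rpow_pos_of_pos hδ H
  set σ := δ ^ H
  have hσ : σ ^ 2 * (N : ℝ) ^ (2 * H) ≤ T ^ (2 * H) := by
    have h2 : σ ^ 2 = δ ^ (2 * H) := by
      rw [mul_comm, Real.rpow_mul hδ.le]; norm_num [σ]
    rw [h2, ← Real.mul_rpow hδ.le (by positivity), mul_comm]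
    exact Real.rpow_le_rpow (by positivity) hN (by positivity)
  have h1 : ∑ j ∈ Finset.range N, ∑ k ∈ Finset.range N,
      |∫ ω, gridIncr X δ j ω / σ * (gridIncr X δ k ω / σ) ∂P| ≤ N * 5 := by
    refine (Finset.sum_le_card_nsmul _ _ 5 fun j _ => ?_).trans (by simp)
    simp only [σ, hX.integral_gridIncr_mul hH hδ]
    exact sum_abs_covH_second_diff_le hH hH1 N j
  have h2 : ∑ j ∈ Finset.range N, ∑ k ∈ Finset.range N,
      |∫ ω, gridIncr X δ j ω / σ * gridMid X δ j ω ∂P| ≤ N * (σ * (N : ℝ) ^ (2 * H)) := by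
    simp only [Finset.sum_const, Finset.card_range, nsmul_eq_mul]
    rw [← Finset.mul_sum]
    gcongr
    have e : ∀ j : ℕ, |∫ ω, gridIncr X δ j ω / σ * gridMid X δ j ω ∂P| =
        σ / 2 * |covH H ((j : ℝ) + 1) ((j : ℝ) + 1) - covH H j j| := by
      intro j
      rw [hX.integral_gridIncr_mul_gridMid hH hδ, mul_div_right_comm, abs_mul,
        abs_of_pos (show 0 < σ / 2 by positivity)]
      push_cast
      rw [covH_comm (j : ℝ) ((j : ℝ) + 1)]
      congr 2
      ring
    simp only [e, ← Finset.mul_sum]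
    nlinarith [sum_abs_covH_diag_sub_le hH N]
  have h3 : ∑ j ∈ Finset.range N, ∑ k ∈ Finset.range N,
      |∫ ω, gridIncr X δ j ω / σ * gridMid X δ k ω ∂P| ≤ N * (2 * σ * (N : ℝ) ^ (2 * H)) := by
    rw [Finset.sum_comm]
    refine (Finset.sum_le_card_nsmul _ _ (2 * σ * (N : ℝ) ^ (2 * H)) fun k hk => ?_).trans
      (by simp)
    have hk := Finset.mem_range.1 hk
    have e : ∀ j : ℕ, |∫ ω, gridIncr X δ j ω / σ * gridMid X δ k ω ∂P| ≤
        σ / 2 * |covH H ((j : ℝ) + 1) (k + 1 : ℕ) - covH H j (k + 1 : ℕ)| +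
        σ / 2 * |covH H ((j : ℝ) + 1) k - covH H j k| := by
      intro j
      rw [hX.integral_gridIncr_mul_gridMid hH hδ, mul_div_right_comm, abs_mul,
        abs_of_pos (show 0 < σ / 2 by positivity), ← mul_add]
      gcongr
      exact abs_add_le _ _
    refine (Finset.sum_le_sum fun j _ => e j).trans ?_
    rw [Finset.sum_add_distrib, ← Finset.mul_sum, ← Finset.mul_sum]
    have s1 := sum_abs_covH_sub_le hH (Nat.succ_le_of_lt hk)
    have s2 := sum_abs_covH_sub_le hH hk.le
    have := mul_le_mul_of_nonneg_left s1 (show 0 ≤ σ / 2 by positivity)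
    have := mul_le_mul_of_nonneg_left s2 (show 0 ≤ σ / 2 by positivity)
    simp only [Nat.succ_eq_add_one] at *
    linarith
  have hb := hX.abs_integral_gridIncr_mul_gridMid_le hH hH1 hδ
  have hle : ∀ j k, pairErr P X H δ j k ≤
      |∫ ω, gridIncr X δ j ω / σ * (gridIncr X δ k ω / σ) ∂P| + 2 * σ *
      |∫ ω, gridIncr X δ j ω / σ * gridMid X δ j ω ∂P| + 2 * σ *
      |∫ ω, gridIncr X δ j ω / σ * gridMid X δ k ω ∂P| := by
    intro j k
    have b1 := hb k j
    have b2 := hb k k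
    unfold pairErr
    rw [add_assoc, ← mul_add, mul_comm (2 * σ)]
    gcongr
    linarith
  refine (Finset.sum_le_sum fun j _ => Finset.sum_le_sum fun k _ => hle j k).trans ?_
  simp only [Finset.sum_add_distrib, ← Finset.mul_sum] at h2 ⊢
  have hN0 : (0 : ℝ) ≤ N := Nat.cast_nonneg N
  have f2 := mul_le_mul_of_nonneg_left h2 (show 0 ≤ 2 * σ by positivity)
  have f3 := mul_le_mul_of_nonneg_left h3 (show 0 ≤ 2 * σ by positivity)
  have f4 := mul_le_mul_of_nonneg_left hσ hN0
  linarith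

/-- Weighted power variation of the pair `(X, Y)` on the grid of mesh `δ`. -/
def powVar (X Y : ℝ → Ω → ℝ) (δ : ℝ) (N a b : ℕ) (g : ℝ → ℝ → ℝ) (ω : Ω) : ℝ :=
  ∑ j ∈ Finset.range N, gridIncr X δ j ω ^ a * gridIncr Y δ j ω ^ b *
    g (gridMid X δ j ω) (gridMid Y δ j ω)

theorem mul_eq_scaled_mul {p q : ℝ} (hp : p ≠ 0) (hq : q ≠ 0) (x y g x' y' g' : ℝ) :
    x * y * g * (x' * y' * g') =
      p * q * p * q * (x / p * (y / q) * g * (x' / p * (y' / q) * g')) := by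
  field_simp

theorem exists_l2_bound [IsProbabilityMeasure P] (hH : 0 < H) (hH1 : H ≤ 1 / 2)
    (hX : IsCenteredGaussianProcess P X (covH H)) (hY : IsCenteredGaussianProcess P Y (covH H))
    (hI : IndepProcesses P X Y) (k b : ℕ) (T : ℝ) {M : ℕ → ℝ} {G : ℕ → ℝ → ℝ → ℝ}
    (hG : PartialDerivSeq M G) :
    ∃ K, ∀ (δ : ℝ) (N : ℕ), 0 < δ → δ ≤ 1 → N * δ ≤ T →
      Integrable (fun ω => powVar X Y δ N (2 * k + 1) b (G 0) ω ^ 2) P ∧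
      ∫ ω, powVar X Y δ N (2 * k + 1) b (G 0) ω ^ 2 ∂P ≤
        K * ((δ ^ H) ^ (2 * (2 * k + 1 + b)) * N) := by
  obtain ⟨C, hC, hb⟩ := exists_pair_bound (P := P) k b M
  refine ⟨C * (5 + 6 * T ^ (2 * H)), fun δ N hδ hδ1 hN => ?_⟩
  have hp : 0 < δ ^ H := Real.rpow_pos_of_pos hδ H
  have hp1 : δ ^ H ≤ 1 := Real.rpow_le_one hδ.le hδ1 hH.le
  have qX := hX.gaussQuad hH hδ
  have qY := hY.gaussQuad hH hδ
  have ind := fun j k => hI.indepFun (measurable_quad_iSup_comap X δ (δ ^ H) j k)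
    (measurable_quad_iSup_comap Y δ (δ ^ H) j k)
  have hα := hX.abs_integral_gridIncr_mul_gridMid_le hH hH1 hδ
  set σ := δ ^ H
  let t : ℕ → ℕ → Ω → ℝ := fun j l ω =>
    ((gridIncr X δ j ω / σ) ^ (2 * k + 1) * (gridIncr Y δ j ω / σ) ^ b *
      G 0 (gridMid X δ j ω) (gridMid Y δ j ω)) *
    ((gridIncr X δ l ω / σ) ^ (2 * k + 1) * (gridIncr Y δ l ω / σ) ^ b *
      G 0 (gridMid X δ l ω) (gridMid Y δ l ω))
  have ht : ∀ j l, Integrable (t j l) P := fun j l =>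
    integrable_pair (qX j l) (qY j l) (ind j l) hG (2 * k + 1) b
  have e : ∀ ω, powVar X Y δ N (2 * k + 1) b (G 0) ω ^ 2 = σ ^ (2 * (2 * k + 1 + b)) *
      ∑ j ∈ Finset.range N, ∑ l ∈ Finset.range N, t j l ω := by
    intro ω
    rw [powVar, sq, Finset.sum_mul_sum, Finset.mul_sum]
    refine Finset.sum_congr rfl fun j _ => ?_
    rw [Finset.mul_sum]
    refine Finset.sum_congr rfl fun l _ => ?_
    simp only [t, div_pow]
    generalize 2 * k + 1 = a
    rw [show 2 * (a + b) = a + b + a + b by ring, pow_add _ (a + b + a), pow_add _ (a + b),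
      pow_add _ a]
    exact mul_eq_scaled_mul (pow_ne_zero _ hp.ne') (pow_ne_zero _ hp.ne') _ _ _ _ _ _
  simp only [e]
  have I2 : ∀ j, Integrable (fun ω => ∑ l ∈ Finset.range N, t j l ω) P := fun j =>
    integrable_finsetSum _ fun l _ => ht j l
  refine ⟨(integrable_finsetSum _ fun j _ => I2 j).const_mul _, ?_⟩
  rw [integral_const_mul, integral_finsetSum _ fun j _ => I2 j]
  have e3 : ∀ j, ∫ ω, ∑ l ∈ Finset.range N, t j l ω ∂P = ∑ l ∈ Finset.range N, ∫ ω, t j l ω ∂P :=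
    fun j => integral_finsetSum _ fun l _ => ht j l
  rw [Finset.sum_congr rfl fun j _ => e3 j]
  have : ∑ j ∈ Finset.range N, ∑ l ∈ Finset.range N, ∫ ω, t j l ω ∂P ≤
      C * (N * (5 + 6 * T ^ (2 * H))) := by
    refine le_trans ?_ (mul_le_mul_of_nonneg_left (hX.sum_pairErr_le hH hH1 hδ hN) hC)
    rw [Finset.mul_sum]
    refine Finset.sum_le_sum fun j _ => ?_
    rw [Finset.mul_sum]
    refine Finset.sum_le_sum fun l _ => ?_
    exact hb _ _ _ _ _ _ _ _ G (qX j l) (qY j l) (ind j l) hG ((hα j j).trans hp1)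
      ((hα j l).trans hp1)
  calc _ ≤ σ ^ (2 * (2 * k + 1 + b)) * (C * (N * (5 + 6 * T ^ (2 * H)))) := by gcongr
    _ = _ := by ring

end l2

section inMeasure
variable [MeasurableSpace Ω] {P : Measure Ω}

theorem tendstoInMeasure_zero_of_pow_le [IsFiniteMeasure P] (p : ℕ)
    {f g : ℕ → Ω → ℝ}
    (hfg : ∀ n ω, |f n ω| ^ p ≤ g n ω) (hg : ∀ n, Integrable (g n) P)
    (hlim : Tendsto (fun n => ∫ ω, g n ω ∂P) atTop (nhds 0)) :
    TendstoInMeasure P f atTop fun _ => 0 := by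
  rw [tendstoInMeasure_iff_norm]
  intro ε hε
  have hεp : 0 < ε ^ p := pow_pos hε p
  have h1 : Tendsto (fun n => ENNReal.ofReal ((∫ ω, g n ω ∂P) / ε ^ p)) atTop (nhds 0) := by
    have := ENNReal.tendsto_ofReal (hlim.div_const (ε ^ p))
    simpa using this
  refine tendsto_of_tendsto_of_tendsto_of_le_of_le tendsto_const_nhds h1 (fun _ => zero_le)
    fun n => ?_
  have hsub : {ω | ε ≤ ‖f n ω - 0‖} ⊆ {ω | ε ^ p ≤ g n ω} := fun ω hω => by
    have hω : ε ≤ |f n ω| := by simpa using hω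
    exact (pow_le_pow_left₀ hε.le hω p).trans (hfg n ω)
  have hm := mul_meas_ge_le_integral_of_nonneg
    (Eventually.of_forall fun ω => (pow_nonneg (abs_nonneg _) p).trans (hfg n ω)) (hg n) (ε ^ p)
  refine (measure_mono hsub).trans ?_
  rw [← ENNReal.ofReal_toReal (measure_ne_top P {ω | ε ^ p ≤ g n ω})]
  refine ENNReal.ofReal_le_ofReal ?_
  rw [le_div_iff₀ hεp, mul_comm]
  exact hm

theorem tendstoInMeasure_add {f g : ℕ → Ω → ℝ} {f' g' : Ω → ℝ}
    (hf : TendstoInMeasure P f atTop f') (hg : TendstoInMeasure P g atTop g') :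
    TendstoInMeasure P (fun n ω => f n ω + g n ω) atTop fun ω => f' ω + g' ω := by
  rw [tendstoInMeasure_iff_norm] at *
  intro ε hε
  have h := (hf (ε / 2) (half_pos hε)).add (hg (ε / 2) (half_pos hε))
  rw [add_zero] at h
  refine tendsto_of_tendsto_of_tendsto_of_le_of_le tendsto_const_nhds h (fun _ => zero_le)
    fun n => (measure_mono fun ω hω => ?_).trans (measure_union_le _ _)
  by_contra hc
  simp only [Set.mem_union, Set.mem_ofPred_eq, not_or, not_le] at hc hω
  have := norm_add_le (f n ω - f' ω) (g n ω - g' ω)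
  rw [show f n ω - f' ω + (g n ω - g' ω) = f n ω + g n ω - (f' ω + g' ω) by ring] at this
  linarith

theorem tendstoInMeasure_const_mul {f : ℕ → Ω → ℝ} (c : ℝ)
    (hf : TendstoInMeasure P f atTop fun _ => 0) :
    TendstoInMeasure P (fun n ω => c * f n ω) atTop fun _ => 0 := by
  rw [tendstoInMeasure_iff_norm] at *
  intro ε hε
  refine tendsto_of_tendsto_of_tendsto_of_le_of_le tendsto_const_nhds
    (hf (ε / (|c| + 1)) (by positivity)) (fun _ => zero_le) fun n => measure_mono fun ω hω => ?_
  simp only [sub_zero, Set.mem_ofPred_eq, norm_mul, Real.norm_eq_abs] at hω ⊢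
  rw [div_le_iff₀ (by positivity)]
  nlinarith [abs_nonneg (f n ω)]

end inMeasure

/-- The mesh `2 ^ (-n / 2)` of the `n`-th dyadic grid. -/
def mesh (n : ℕ) : ℝ := (2 : ℝ) ^ (-(n : ℝ) / 2)

theorem mesh_pos (n : ℕ) : 0 < mesh n := Real.rpow_pos_of_pos two_pos _

theorem mesh_le_one (n : ℕ) : mesh n ≤ 1 :=
  Real.rpow_le_one_of_one_le_of_nonpos one_le_two (by
    have : (0 : ℝ) ≤ n := Nat.cast_nonneg n
    linarith)

theorem tendsto_mesh : Tendsto mesh atTop (nhds 0) := by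
  have h : mesh = fun n => ((2 : ℝ) ^ (-(1 / 2) : ℝ)) ^ n := by
    ext n
    rw [mesh, ← Real.rpow_natCast, ← Real.rpow_mul two_pos.le]
    congr 1
    ring
  rw [h]
  exact tendsto_pow_atTop_nhds_zero_of_lt_one (by positivity)
    (Real.rpow_lt_one_of_one_lt_of_neg one_lt_two (by norm_num))

theorem nSteps_eq (n : ℕ) (t : ℝ) : nSteps n t = ⌊t / mesh n⌋₊ := by
  rw [nSteps, mesh, neg_div, Real.rpow_neg two_pos.le, div_inv_eq_mul, mul_comm]

theorem nSteps_mul_mesh_le (n : ℕ) {t : ℝ} (ht : 0 ≤ t) : nSteps n t * mesh n ≤ t := by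
  rw [nSteps_eq, ← le_div_iff₀ (mesh_pos n)]
  exact Nat.floor_le (div_nonneg ht (mesh_pos n).le)

theorem tendsto_nSteps_mul_mesh {t : ℝ} (ht : 0 ≤ t) :
    Tendsto (fun n => nSteps n t * mesh n) atTop (nhds t) := by
  refine tendsto_of_tendsto_of_tendsto_of_le_of_le (g := fun n => t - mesh n)
    (by simpa using tendsto_mesh.const_sub t) tendsto_const_nhds (fun n => ?_)
    fun n => nSteps_mul_mesh_le n ht
  have h := Nat.lt_floor_add_one (t / mesh n)
  rw [← nSteps_eq, div_lt_iff₀ (mesh_pos n)] at h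
  show t - mesh n ≤ nSteps n t * mesh n
  linarith

theorem tendsto_mesh_pow_mul_nSteps {H : ℝ} {p : ℕ} (hp : 1 < p * H) {t : ℝ} (ht : 0 ≤ t) :
    Tendsto (fun n => (mesh n ^ H) ^ p * nSteps n t) atTop (nhds 0) := by
  have h1 : Tendsto (fun n => t * mesh n ^ (p * H - 1)) atTop (nhds 0) := by
    have := (tendsto_mesh.rpow_const (p := p * H - 1) (Or.inr (by linarith))).const_mul t
    simpa [Real.zero_rpow (show p * H - 1 ≠ 0 by linarith)] using this
  refine tendsto_of_tendsto_of_tendsto_of_le_of_le tendsto_const_nhds h1 (fun n => ?_) fun n => ?_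
  · have := (mesh_pos n).le
    positivity
  · have hm := mesh_pos n
    have e : (mesh n ^ H) ^ p = mesh n ^ (p * H - 1) * mesh n := by
      rw [← Real.rpow_natCast, ← Real.rpow_mul hm.le, mul_comm H, Real.rpow_sub_one hm.ne']
      field_simp
    show (mesh n ^ H) ^ p * nSteps n t ≤ _
    rw [e]
    have := mul_le_mul_of_nonneg_right (nSteps_mul_mesh_le n ht)
      (Real.rpow_nonneg hm.le (p * H - 1))
    linarith

/-- Absolute power variation of the pair `(X, Y)` on the grid of mesh `δ`. -/
def absPowVar (X Y : ℝ → Ω → ℝ) (δ : ℝ) (N a b : ℕ) (ω : Ω) : ℝ :=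
  ∑ j ∈ Finset.range N, |gridIncr X δ j ω| ^ a * |gridIncr Y δ j ω| ^ b

theorem absPowVar_nonneg (X Y : ℝ → Ω → ℝ) (δ : ℝ) (N a b : ℕ) (ω : Ω) :
    0 ≤ absPowVar X Y δ N a b ω :=
  Finset.sum_nonneg fun _ _ => by positivity

theorem powVar_swap (X Y : ℝ → Ω → ℝ) (δ : ℝ) (N a b : ℕ) (g : ℝ → ℝ → ℝ) :
    powVar X Y δ N a b g = powVar Y X δ N b a fun y x => g x y := by
  ext ω
  exact Finset.sum_congr rfl fun j _ => by ring

section l1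
variable [MeasurableSpace Ω] {P : Measure Ω} {X Y : ℝ → Ω → ℝ} {H : ℝ}

theorem absPowVar_integrable_and_le [IsProbabilityMeasure P] (hH : 0 < H)
    (hX : IsCenteredGaussianProcess P X (covH H)) (hY : IsCenteredGaussianProcess P Y (covH H))
    (a b : ℕ) {δ : ℝ} (hδ : 0 < δ) (N : ℕ) :
    Integrable (absPowVar X Y δ N a b) P ∧ ∫ ω, absPowVar X Y δ N a b ω ∂P ≤
      (absMoment (2 * a) + absMoment (2 * b)) * ((δ ^ H) ^ (a + b) * N) := by
  have hp : 0 < δ ^ H := Real.rpow_pos_of_pos hδ H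
  have mX : ∀ j, Measurable fun ω => gridIncr X δ j ω / δ ^ H := fun j =>
    (hX.measurable_gridIncr j).div_const _
  have mY : ∀ j, Measurable fun ω => gridIncr Y δ j ω / δ ^ H := fun j =>
    (hY.measurable_gridIncr j).div_const _
  have e : ∀ j ω, |gridIncr X δ j ω| ^ a * |gridIncr Y δ j ω| ^ b = (δ ^ H) ^ (a + b) *
      (|gridIncr X δ j ω / δ ^ H| ^ a * |gridIncr Y δ j ω / δ ^ H| ^ b) := by
    intro j ω
    rw [abs_div, abs_div, abs_of_pos hp, div_pow, div_pow, pow_add]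
    have h1 := (pow_pos hp a).ne'
    have h2 := (pow_pos hp b).ne'
    generalize (δ ^ H) ^ a = p at *
    generalize (δ ^ H) ^ b = q at *
    field_simp
  have I : ∀ j, Integrable (fun ω => |gridIncr X δ j ω| ^ a * |gridIncr Y δ j ω| ^ b) P := by
    intro j
    simp only [e]
    exact (integrable_abs_pow_mul (mX j) (hX.map_gridIncr hH hδ j) (mY j)
      (hY.map_gridIncr hH hδ j) a b).const_mul _
  refine ⟨integrable_finsetSum _ fun j _ => I j, ?_⟩
  unfold absPowVar
  rw [integral_finsetSum _ fun j _ => I j]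
  refine (Finset.sum_le_card_nsmul _ _ ((δ ^ H) ^ (a + b) *
    (absMoment (2 * a) + absMoment (2 * b))) fun j _ => ?_).trans (le_of_eq ?_)
  · simp only [e]
    rw [integral_const_mul]
    exact mul_le_mul_of_nonneg_left (integral_abs_pow_mul_le (mX j) (hX.map_gridIncr hH hδ j) (mY j)
      (hY.map_gridIncr hH hδ j) a b) (by positivity)
  · simp only [Finset.card_range, nsmul_eq_mul]
    ring

theorem tendsto_integral_absPowVar [IsProbabilityMeasure P] (hH : 0 < H)
    (hX : IsCenteredGaussianProcess P X (covH H)) (hY : IsCenteredGaussianProcess P Y (covH H))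
    {a b : ℕ} (hab : 1 < ((a + b : ℕ) : ℝ) * H) {t : ℝ} (ht : 0 ≤ t) :
    Tendsto (fun n => ∫ ω, absPowVar X Y (mesh n) (nSteps n t) a b ω ∂P) atTop (nhds 0) := by
  have h := (tendsto_mesh_pow_mul_nSteps hab ht).const_mul (absMoment (2 * a) + absMoment (2 * b))
  rw [mul_zero] at h
  exact tendsto_of_tendsto_of_tendsto_of_le_of_le tendsto_const_nhds h
    (fun n => integral_nonneg fun ω => absPowVar_nonneg _ _ _ _ _ _ ω)
    fun n => (absPowVar_integrable_and_le hH hX hY a b (mesh_pos n) _).2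

/-- Weighted odd power variations of total order at least three vanish in the limit. -/
theorem tendsto_powVar_odd_left [IsProbabilityMeasure P] (hH : 1 / 6 < H)
    (hX : IsCenteredGaussianProcess P X (covH H)) (hY : IsCenteredGaussianProcess P Y (covH H))
    (hI : IndepProcesses P X Y) {k b : ℕ} (hkb : 3 ≤ 2 * k + 1 + b) {M : ℕ → ℝ}
    {G : ℕ → ℝ → ℝ → ℝ} (hG : PartialDerivSeq M G) {t : ℝ} (ht : 0 ≤ t) :
    TendstoInMeasure P (fun n => powVar X Y (mesh n) (nSteps n t) (2 * k + 1) b (G 0)) atTop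
      fun _ => 0 := by
  have hH0 : 0 < H := by linarith
  have hσ : ∀ n, 0 ≤ mesh n ^ H := fun n => Real.rpow_nonneg (mesh_pos n).le H
  have hσ1 : ∀ n, mesh n ^ H ≤ 1 := fun n => Real.rpow_le_one (mesh_pos n).le (mesh_le_one n) hH0.le
  rcases le_or_gt H (1 / 2) with h2 | h2
  · obtain ⟨K, hK⟩ := exists_l2_bound hH0 h2 hX hY hI k b t hG
    have hK := fun n => hK (mesh n) (nSteps n t) (mesh_pos n) (mesh_le_one n)
      (nSteps_mul_mesh_le n ht)
    refine tendstoInMeasure_zero_of_pow_le 2 (fun n ω => (sq_abs _).le)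
      (fun n => (hK n).1) ?_
    have hlim := (tendsto_mesh_pow_mul_nSteps (H := H) (p := 2 * (2 * k + 1 + b)) (t := t) (by
      have : (6 : ℝ) ≤ (2 * (2 * k + 1 + b) : ℕ) := by exact_mod_cast (by omega)
      nlinarith) ht).const_mul K
    rw [mul_zero] at hlim
    exact tendsto_of_tendsto_of_tendsto_of_le_of_le tendsto_const_nhds hlim
      (fun n => integral_nonneg fun ω => sq_nonneg _) fun n => (hK n).2
  · have hb := fun n => absPowVar_integrable_and_le hH0 hX hY (2 * k + 1) b (mesh_pos n)
      (nSteps n t)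
    refine tendstoInMeasure_zero_of_pow_le 1
      (g := fun n ω => M 0 * absPowVar X Y (mesh n) (nSteps n t) (2 * k + 1) b ω)
      (fun n ω => ?_) (fun n => (hb n).1.const_mul _) ?_
    · rw [pow_one, powVar, absPowVar, Finset.mul_sum]
      refine (Finset.abs_sum_le_sum_abs _ _).trans (Finset.sum_le_sum fun j _ => ?_)
      rw [abs_mul, abs_mul, abs_pow, abs_pow, mul_comm]
      exact mul_le_mul_of_nonneg_right ((hG.seq _).bound 0 _) (by positivity)
    · simp only [integral_const_mul]
      have := (tendsto_integral_absPowVar (P := P) hH0 hX hY (a := 2 * k + 1) (b := b) (by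
        have : (3 : ℝ) ≤ (2 * k + 1 + b : ℕ) := by exact_mod_cast hkb
        nlinarith) ht).const_mul (M 0)
      rwa [mul_zero] at this

end l1

section smooth
variable {E : Type*} [NormedAddCommGroup E] [NormedSpace ℝ E]

/-- The derivative of `g` in the direction `v`. -/
def dirDeriv (v : E) (g : E → ℝ) (p : E) : ℝ := fderiv ℝ g p v

namespace CbSmooth
variable {g : E → ℝ}

theorem continuous (hg : CbSmooth g) : Continuous g := (hg.1 0).continuous

theorem hasFDerivAt (hg : CbSmooth g) (p : E) : HasFDerivAt g (fderiv ℝ g p) p :=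
  ((hg.1 1).differentiable (by simp)).differentiableAt.hasFDerivAt

theorem exists_bound (hg : CbSmooth g) : ∃ M, ∀ p, |g p| ≤ M := by
  obtain ⟨M, hM⟩ := hg.2 0
  exact ⟨M, fun p => by simpa using hM p⟩

theorem smooth_dirDeriv (hg : CbSmooth g) (v : E) : CbSmooth (dirDeriv v g) := by
  have hd : ∀ n : ℕ, ContDiff ℝ n (fderiv ℝ g) := fun n =>
    (hg.1 (n + 1)).fderiv_right (by norm_cast)
  refine ⟨fun n => (hd n).clm_apply contDiff_const, fun k => ?_⟩
  obtain ⟨M, hM⟩ := hg.2 (k + 1)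
  let L : (E →L[ℝ] ℝ) →L[ℝ] ℝ := ContinuousLinearMap.apply ℝ ℝ v
  refine ⟨‖L‖ * M, fun x => ?_⟩
  have h := L.norm_iteratedFDeriv_comp_left (f := fderiv ℝ g) (x := x) (N := k)
    (hd k).contDiffAt le_rfl
  rw [norm_iteratedFDeriv_fderiv] at h
  exact h.trans (mul_le_mul_of_nonneg_left (hM x) (norm_nonneg _))

theorem smooth_iterate_dirDeriv (hg : CbSmooth g) (v : E) (i : ℕ) :
    CbSmooth ((dirDeriv v)^[i] g) := by
  induction i with
  | zero => exact hg
  | succ i ih =>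
    rw [Function.iterate_succ_apply']
    exact ih.smooth_dirDeriv v

end CbSmooth
end smooth

section plane
variable {g : ℝ × ℝ → ℝ}

theorem CbSmooth.exists_partialDerivSeq_left (hg : CbSmooth g) :
    ∃ M G, PartialDerivSeq M G ∧ G 0 = fun x y => g (x, y) := by
  choose M hM using fun i => (hg.smooth_iterate_dirDeriv (1, 0) i).exists_bound
  refine ⟨M, fun i x y => (dirDeriv (1, 0))^[i] g (x, y), ⟨hg.continuous, fun y =>
    ⟨fun i x => ?_, fun i x => hM i _⟩⟩, rfl⟩
  have h := ((hg.smooth_iterate_dirDeriv (1, 0) i).hasFDerivAt (x, y)).comp_hasDerivAt x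
    ((hasDerivAt_id x).prodMk (hasDerivAt_const x y))
  rw [Function.iterate_succ_apply']
  exact h

theorem CbSmooth.exists_partialDerivSeq_right (hg : CbSmooth g) :
    ∃ M G, PartialDerivSeq M G ∧ G 0 = fun y x => g (x, y) := by
  choose M hM using fun i => (hg.smooth_iterate_dirDeriv (0, 1) i).exists_bound
  refine ⟨M, fun i y x => (dirDeriv (0, 1))^[i] g (x, y),
    ⟨hg.continuous.comp continuous_swap, fun x => ⟨fun i y => ?_, fun i y => hM i _⟩⟩, rfl⟩
  have h := ((hg.smooth_iterate_dirDeriv (0, 1) i).hasFDerivAt (x, y)).comp_hasDerivAt y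
    ((hasDerivAt_const y x).prodMk (hasDerivAt_id y))
  rw [Function.iterate_succ_apply']
  exact h

theorem fderiv_prod_apply (p h : ℝ × ℝ) :
    fderiv ℝ g p h = h.1 * dirDeriv (1, 0) g p + h.2 * dirDeriv (0, 1) g p := by
  have e : h = h.1 • ((1, 0) : ℝ × ℝ) + h.2 • ((0, 1) : ℝ × ℝ) := by ext <;> simp
  conv_lhs => rw [e]
  rw [map_add, map_smul, map_smul]
  rfl

/-- The `k`-th derivative of `g` along the direction `h`, expanded in partial derivatives. -/
def alongDeriv : ℕ → (ℝ × ℝ → ℝ) → ℝ × ℝ → ℝ × ℝ → ℝ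
  | 0, g, _, p => g p
  | k + 1, g, h, p =>
    h.1 * alongDeriv k (dirDeriv (1, 0) g) h p + h.2 * alongDeriv k (dirDeriv (0, 1) g) h p

theorem CbSmooth.hasDerivAt_alongDeriv (k : ℕ) (hg : CbSmooth g) (m h : ℝ × ℝ) (s : ℝ) :
    HasDerivAt (fun s : ℝ => alongDeriv k g h (m + s • h))
      (alongDeriv (k + 1) g h (m + s • h)) s := by
  induction k generalizing g with
  | zero =>
    have h1 : HasDerivAt (fun s : ℝ => m + s • h) h s := by
      simpa using ((hasDerivAt_id s).smul_const h).const_add m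
    have h2 := (hg.hasFDerivAt (m + s • h)).comp_hasDerivAt s h1
    rw [fderiv_prod_apply] at h2
    exact h2
  | succ k ih =>
    exact ((ih (hg.smooth_dirDeriv _)).const_mul h.1).add ((ih (hg.smooth_dirDeriv _)).const_mul h.2)

theorem CbSmooth.exists_bound_alongDeriv (k : ℕ) (hg : CbSmooth g) :
    ∃ C, 0 ≤ C ∧ ∀ h p : ℝ × ℝ, |alongDeriv k g h p| ≤ C * (|h.1| + |h.2|) ^ k := by
  induction k generalizing g with
  | zero =>
    obtain ⟨M, hM⟩ := hg.exists_bound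
    exact ⟨M, (abs_nonneg _).trans (hM 0), fun h p => by simpa [alongDeriv] using hM p⟩
  | succ k ih =>
    obtain ⟨C, hC, h1⟩ := ih (hg.smooth_dirDeriv (1, 0))
    obtain ⟨D, hD, h2⟩ := ih (hg.smooth_dirDeriv (0, 1))
    refine ⟨C + D, by positivity, fun h p => ?_⟩
    rw [alongDeriv]
    refine (abs_add_le _ _).trans ?_
    rw [abs_mul, abs_mul]
    calc _ ≤ |h.1| * (C * (|h.1| + |h.2|) ^ k) + |h.2| * (D * (|h.1| + |h.2|) ^ k) := by
          gcongr
          · exact h1 h p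
          · exact h2 h p
      _ ≤ (|h.1| + |h.2|) * (C * (|h.1| + |h.2|) ^ k) +
          (|h.1| + |h.2|) * (D * (|h.1| + |h.2|) ^ k) := by
          gcongr <;> simp
      _ = _ := by ring

end plane

section taylor

theorem abs_sub_taylor_le {B : ℝ} (k : ℕ) {φ : ℕ → ℝ → ℝ}
    (hφ : ∀ i s, HasDerivAt (φ i) (φ (i + 1) s) s) (hB : ∀ s, |φ k s| ≤ B) (x : ℝ) :
    |φ 0 x - ∑ i ∈ Finset.range k, φ i 0 * x ^ i / (i.factorial : ℝ)| ≤ B * |x| ^ k := by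
  have hB0 : 0 ≤ B := (abs_nonneg _).trans (hB 0)
  induction k generalizing φ x with
  | zero => simpa using hB x
  | succ k ih =>
    have hd : ∀ y, HasDerivAt
        (fun y => φ 0 y - ∑ i ∈ Finset.range (k + 1), φ i 0 * y ^ i / (i.factorial : ℝ))
        (φ 1 y - ∑ i ∈ Finset.range k, φ (i + 1) 0 * y ^ i / (i.factorial : ℝ)) y := by
      intro y
      simp only [Finset.sum_range_succ' _ k, pow_zero]
      refine (hφ 0 y).fun_sub (HasDerivAt.add_const _ (HasDerivAt.fun_sum fun i _ => ?_))
      have h := ((hasDerivAt_pow (i + 1) y).const_mul (φ (i + 1) 0)).div_const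
        ((i + 1).factorial : ℝ)
      refine h.congr_deriv ?_
      have : (i.factorial : ℝ) ≠ 0 := by positivity
      rw [Nat.factorial_succ]
      push_cast
      field_simp
    have hle : ∀ y ∈ Set.uIcc 0 x,
        ‖φ 1 y - ∑ i ∈ Finset.range k, φ (i + 1) 0 * y ^ i / (i.factorial : ℝ)‖ ≤
          B * |x| ^ k := by
      intro y hy
      refine (ih (fun i s => hφ (i + 1) s) hB y).trans ?_
      have hy' : |y| ≤ |x| := by simpa using Set.abs_sub_left_of_mem_uIcc hy
      exact mul_le_mul_of_nonneg_left (pow_le_pow_left₀ (abs_nonneg y) hy' k) hB0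
    have h := (convex_uIcc 0 x).norm_image_sub_le_of_norm_hasDerivWithin_le
      (fun y _ => (hd y).hasDerivWithinAt) hle Set.left_mem_uIcc Set.right_mem_uIcc
    rw [Finset.sum_range_succ' (fun i => φ i 0 * (0 : ℝ) ^ i / (i.factorial : ℝ))] at h
    simpa [pow_succ, mul_assoc] using h

theorem abs_midpoint_taylor_le {B : ℝ} {φ : ℕ → ℝ → ℝ}
    (hφ : ∀ i s, HasDerivAt (φ i) (φ (i + 1) s) s) (hB : ∀ s, |φ 6 s| ≤ B) :
    |φ 0 (1 / 2) - φ 0 (-(1 / 2)) - φ 1 0 - φ 3 0 / 24 - φ 5 0 / 1920| ≤ B := by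
  have hB0 : 0 ≤ B := (abs_nonneg _).trans (hB 0)
  have h1 := abs_le.1 (abs_sub_taylor_le 6 hφ hB (1 / 2))
  have h2 := abs_le.1 (abs_sub_taylor_le 6 hφ hB (-(1 / 2)))
  norm_num [Finset.sum_range_succ, Nat.factorial] at h1 h2
  rw [abs_le]
  constructor <;> linarith

end taylor

theorem Xincr_eq_gridIncr (X : ℝ → Ω → ℝ) (n j : ℕ) (ω : Ω) :
    Xincr X n j ω = gridIncr X (mesh n) j ω := by
  simp [Xincr, gridIncr, dyadicPt, mesh]

theorem Xmid_eq (X Y : ℝ → Ω → ℝ) (g : ℝ → ℝ → ℝ) (n j : ℕ) (ω : Ω) :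
    Xmid X Y g n j ω = g (gridMid X (mesh n) j ω) (gridMid Y (mesh n) j ω) := by
  simp [Xmid, gridMid, dyadicPt, mesh]

theorem pd_one_zero {f : ℝ → ℝ → ℝ} (hf : CbSmooth2 f) (x y : ℝ) :
    pd 1 0 f x y = dirDeriv (1, 0) (fun p : ℝ × ℝ => f p.1 p.2) (x, y) := by
  simp only [pd, iteratedDeriv_one, iteratedDeriv_zero]
  exact ((hf.hasFDerivAt (x, y)).comp_hasDerivAt x
    ((hasDerivAt_id x).prodMk (hasDerivAt_const x y))).deriv

theorem pd_zero_one {f : ℝ → ℝ → ℝ} (hf : CbSmooth2 f) (x y : ℝ) :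
    pd 0 1 f x y = dirDeriv (0, 1) (fun p : ℝ × ℝ => f p.1 p.2) (x, y) := by
  simp only [pd, iteratedDeriv_one, iteratedDeriv_zero]
  exact ((hf.hasFDerivAt (x, y)).comp_hasDerivAt y
    ((hasDerivAt_const y x).prodMk (hasDerivAt_id y))).deriv

/-- The increments of the pair `(X, Y)` along the grid of mesh `δ`. -/
def pairIncr (X Y : ℝ → Ω → ℝ) (δ : ℝ) (j : ℕ) (ω : Ω) : ℝ × ℝ :=
  (gridIncr X δ j ω, gridIncr Y δ j ω)

/-- The midpoints of the pair `(X, Y)` along the grid of mesh `δ`. -/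
def pairMid (X Y : ℝ → Ω → ℝ) (δ : ℝ) (j : ℕ) (ω : Ω) : ℝ × ℝ :=
  (gridMid X δ j ω, gridMid Y δ j ω)

/-- Sum over the grid of the `k`-th derivatives of `g` at the midpoints along the increments,
with additional weights `ΔX ^ a * ΔY ^ b`. -/
def alongSum (X Y : ℝ → Ω → ℝ) (δ : ℝ) (N a b k : ℕ) (g : ℝ × ℝ → ℝ) (ω : Ω) : ℝ :=
  ∑ j ∈ Finset.range N, gridIncr X δ j ω ^ a * gridIncr Y δ j ω ^ b *
    alongDeriv k g (pairIncr X Y δ j ω) (pairMid X Y δ j ω)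

theorem alongSum_succ (X Y : ℝ → Ω → ℝ) (δ : ℝ) (N a b k : ℕ) (g : ℝ × ℝ → ℝ) (ω : Ω) :
    alongSum X Y δ N a b (k + 1) g ω = alongSum X Y δ N (a + 1) b k (dirDeriv (1, 0) g) ω +
      alongSum X Y δ N a (b + 1) k (dirDeriv (0, 1) g) ω := by
  unfold alongSum
  rw [← Finset.sum_add_distrib]
  refine Finset.sum_congr rfl fun j _ => ?_
  rw [alongDeriv]
  simp only [pairIncr]
  ring

theorem abs_increment_sub_le {g : ℝ × ℝ → ℝ} (hg : CbSmooth g) :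
    ∃ C, 0 ≤ C ∧ ∀ m h : ℝ × ℝ, |g (m + (1 / 2 : ℝ) • h) - g (m + (-(1 / 2) : ℝ) • h) -
      alongDeriv 1 g h m - alongDeriv 3 g h m / 24 - alongDeriv 5 g h m / 1920| ≤
      C * (|h.1| ^ 6 + |h.2| ^ 6) := by
  obtain ⟨C, hC, hb⟩ := hg.exists_bound_alongDeriv 6
  refine ⟨C * 2 ^ 5, by positivity, fun m h => ?_⟩
  have key := abs_midpoint_taylor_le (φ := fun i s => alongDeriv i g h (m + s • h))
    (fun i s => hg.hasDerivAt_alongDeriv i m h s) (fun s => hb h (m + s • h))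
  simp only [zero_smul, add_zero] at key
  refine key.trans ?_
  rw [mul_assoc]
  exact mul_le_mul_of_nonneg_left (add_pow_le (abs_nonneg _) (abs_nonneg _) 6) hC

theorem sum_increment_eq (X Y : ℝ → Ω → ℝ) (g : ℝ × ℝ → ℝ) (δ : ℝ) (N : ℕ) (ω : Ω) :
    ∑ j ∈ Finset.range N, (g (pairMid X Y δ j ω + (1 / 2 : ℝ) • pairIncr X Y δ j ω) -
      g (pairMid X Y δ j ω + (-(1 / 2) : ℝ) • pairIncr X Y δ j ω)) =
    g (X (N * δ) ω, Y (N * δ) ω) - g (X 0 ω, Y 0 ω) := by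
  have h := Finset.sum_range_sub (fun j : ℕ => g (X (j * δ) ω, Y (j * δ) ω)) N
  simp only [Nat.cast_zero, zero_mul] at h
  rw [← h]
  refine Finset.sum_congr rfl fun j _ => ?_
  congr 2 <;> ext <;> simp [pairMid, pairIncr, gridMid, gridIncr] <;> ring

section limit
variable [MeasurableSpace Ω] {P : Measure Ω} {X Y : ℝ → Ω → ℝ} {H : ℝ}

theorem tendsto_alongSum [IsProbabilityMeasure P] (hH : 1 / 6 < H)
    (hX : IsCenteredGaussianProcess P X (covH H)) (hY : IsCenteredGaussianProcess P Y (covH H))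
    (hI : IndepProcesses P X Y) {t : ℝ} (ht : 0 ≤ t) (k : ℕ) {a b : ℕ} (hodd : Odd (a + b + k))
    (h3 : 3 ≤ a + b + k) {g : ℝ × ℝ → ℝ} (hg : CbSmooth g) :
    TendstoInMeasure P (fun n => alongSum X Y (mesh n) (nSteps n t) a b k g) atTop
      fun _ => 0 := by
  induction k generalizing a b g with
  | zero =>
    rcases Nat.even_or_odd a with ha | ⟨c, rfl⟩
    · obtain ⟨c, rfl⟩ : Odd b := by
        rcases Nat.even_or_odd b with hb | hb
        · exact absurd hodd (by simpa using ha.add hb)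
        · exact hb
      obtain ⟨M, G, hG, hG0⟩ := hg.exists_partialDerivSeq_right
      have h := tendsto_powVar_odd_left hH hY hX hI.symm (k := c) (b := a) (by omega) hG ht
      simp only [hG0, powVar_swap Y X] at h
      exact h
    · obtain ⟨M, G, hG, hG0⟩ := hg.exists_partialDerivSeq_left
      have h := tendsto_powVar_odd_left hH hX hY hI (k := c) (b := b) (by omega) hG ht
      rw [hG0] at h
      exact h
  | succ k ih =>
    have h1 := ih (a := a + 1) (b := b) (by convert hodd using 1; ring) (by omega)
      (hg.smooth_dirDeriv (1, 0))
    have h2 := ih (a := a) (b := b + 1) (by convert hodd using 1; ring) (by omega)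
      (hg.smooth_dirDeriv (0, 1))
    have h := tendstoInMeasure_add h1 h2
    simp only [← alongSum_succ, add_zero] at h
    exact h

end limit

section remainder
variable [MeasurableSpace Ω] {P : Measure Ω} {X Y : ℝ → Ω → ℝ} {H : ℝ}

/-- The error made on the grid of mesh `δ` by the fifth order midpoint expansion. -/
def taylorRemainder (X Y : ℝ → Ω → ℝ) (g : ℝ × ℝ → ℝ) (δ : ℝ) (N : ℕ) (ω : Ω) : ℝ :=
  g (X (N * δ) ω, Y (N * δ) ω) - g (X 0 ω, Y 0 ω) - alongSum X Y δ N 0 0 1 g ω -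
    1 / 24 * alongSum X Y δ N 0 0 3 g ω - 1 / 1920 * alongSum X Y δ N 0 0 5 g ω

theorem tendsto_taylorRemainder [IsProbabilityMeasure P] (hH : 1 / 6 < H)
    (hX : IsCenteredGaussianProcess P X (covH H)) (hY : IsCenteredGaussianProcess P Y (covH H))
    {t : ℝ} (ht : 0 ≤ t) {g : ℝ × ℝ → ℝ} (hg : CbSmooth g) :
    TendstoInMeasure P (fun n => taylorRemainder X Y g (mesh n) (nSteps n t)) atTop
      fun _ => 0 := by
  have hH0 : 0 < H := by linarith
  obtain ⟨C, hC, hb⟩ := abs_increment_sub_le hg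
  have I : ∀ (a b n : ℕ), Integrable (absPowVar X Y (mesh n) (nSteps n t) a b) P := fun a b n =>
    (absPowVar_integrable_and_le hH0 hX hY a b (mesh_pos n) (nSteps n t)).1
  refine tendstoInMeasure_zero_of_pow_le 1
    (g := fun n ω => C * (absPowVar X Y (mesh n) (nSteps n t) 6 0 ω +
      absPowVar X Y (mesh n) (nSteps n t) 0 6 ω))
    (fun n ω => ?_) (fun n => ((I 6 0 n).add (I 0 6 n)).const_mul C) ?_
  · rw [pow_one, taylorRemainder, ← sum_increment_eq]
    simp only [alongSum, absPowVar, Finset.mul_sum, ← Finset.sum_sub_distrib,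
      ← Finset.sum_add_distrib]
    refine (Finset.abs_sum_le_sum_abs _ _).trans (Finset.sum_le_sum fun j _ => ?_)
    refine le_of_eq_of_le ?_ ((hb (pairMid X Y (mesh n) j ω) (pairIncr X Y (mesh n) j ω)).trans_eq
      ?_)
    · congr 1
      ring
    · simp [pairIncr]
  · have h6 : 1 < (6 : ℝ) * H := by linarith
    have h1 := tendsto_integral_absPowVar (a := 6) (b := 0) hH0 hX hY (by exact_mod_cast h6) ht
    have h2 := tendsto_integral_absPowVar (a := 0) (b := 6) hH0 hX hY (by exact_mod_cast h6) ht
    have h := (h1.add h2).const_mul C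
    simp only [add_zero, mul_zero] at h
    refine h.congr fun n => ?_
    rw [integral_const_mul, integral_add (I 6 0 n) (I 0 6 n)]

theorem tendsto_endpoint [IsProbabilityMeasure P] (hH : 0 < H)
    (hX : IsCenteredGaussianProcess P X (covH H)) (hY : IsCenteredGaussianProcess P Y (covH H))
    (hcX : ∀ ω, Continuous fun u => X u ω) (hcY : ∀ ω, Continuous fun u => Y u ω)
    {t : ℝ} (ht : 0 ≤ t) {g : ℝ × ℝ → ℝ} (hg : Continuous g) :
    TendstoInMeasure P (fun n ω => g (X (nSteps n t * mesh n) ω, Y (nSteps n t * mesh n) ω) -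
      g (X 0 ω, Y 0 ω)) atTop fun ω => g (X t ω, Y t ω) - g (0, 0) := by
  have m : ∀ s, Measurable fun ω => g (X s ω, Y s ω) := fun s =>
    hg.measurable.comp ((hX.measurable s).prodMk (hY.measurable s))
  refine tendstoInMeasure_of_tendsto_ae
    (fun n => ((m _).sub (m 0)).aestronglyMeasurable) ?_
  filter_upwards [hX.ae_eq_zero hH, hY.ae_eq_zero hH] with ω h1 h2
  rw [h1, h2]
  have hs := tendsto_nSteps_mul_mesh ht
  exact ((hg.tendsto _).comp ((((hcX ω).tendsto t).comp hs).prodMk_nhds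
    (((hcY ω).tendsto t).comp hs))).sub_const _

end remainder

theorem ito_formula_2D_fbm_high_hurst
    {Ω : Type*} [MeasurableSpace Ω] (P : Measure Ω) [IsProbabilityMeasure P]
    (H : ℝ) (hH1 : (1 : ℝ) / 6 < H) (hH2 : H < 1)
    (X1 X2 : ℝ → Ω → ℝ)
    (hX1 : IsCenteredGaussianProcess P X1 (covH H))
    (hX2 : IsCenteredGaussianProcess P X2 (covH H))
    (hInd : IndepProcesses P X1 X2)
    (hc1 : ∀ ω, Continuous fun u => X1 u ω)
    (hc2 : ∀ ω, Continuous fun u => X2 u ω)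
    (f : ℝ → ℝ → ℝ) (hf : CbSmooth2 f)
    (t : ℝ) (ht : 0 < t) :
    TendstoInMeasure P
      (fun (n : ℕ) ω => ∑ j ∈ Finset.range (nSteps n t),
        (Xmid X1 X2 (pd 1 0 f) n j ω * Xincr X1 n j ω +
          Xmid X1 X2 (pd 0 1 f) n j ω * Xincr X2 n j ω))
      atTop
      (fun ω => f (X1 t ω) (X2 t ω) - f 0 0) := by
  set F : ℝ × ℝ → ℝ := fun p => f p.1 p.2 with hF
  have hsum : ∀ n ω, ∑ j ∈ Finset.range (nSteps n t),
      (Xmid X1 X2 (pd 1 0 f) n j ω * Xincr X1 n j ω +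
        Xmid X1 X2 (pd 0 1 f) n j ω * Xincr X2 n j ω) =
      alongSum X1 X2 (mesh n) (nSteps n t) 0 0 1 F ω := by
    intro n ω
    refine Finset.sum_congr rfl fun j _ => ?_
    simp only [Xmid_eq, Xincr_eq_gridIncr, pd_one_zero hf, pd_zero_one hf, alongDeriv, pairIncr,
      pairMid, hF]
    ring
  have h3 := tendstoInMeasure_const_mul (-(1 / 24)) (tendsto_alongSum hH1 hX1 hX2 hInd ht.le 3
    (a := 0) (b := 0) (by decide) le_rfl hf)
  have h5 := tendstoInMeasure_const_mul (-(1 / 1920)) (tendsto_alongSum hH1 hX1 hX2 hInd ht.le 5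
    (a := 0) (b := 0) (by decide) (by norm_num) hf)
  have hR := tendstoInMeasure_const_mul (-1) (tendsto_taylorRemainder hH1 hX1 hX2 ht.le hf)
  have hE := tendsto_endpoint (by linarith) hX1 hX2 hc1 hc2 ht.le hf.continuous
  have h := tendstoInMeasure_add hE (tendstoInMeasure_add h3 (tendstoInMeasure_add h5 hR))
  simp only [add_zero] at h
  refine h.congr (fun n => Eventually.of_forall fun ω => ?_) (Eventually.of_forall fun ω => rfl)
  simp only [hsum, taylorRemainder, hF]
  ring

end
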